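/- arXiv:1603.00071 — 9 statements merged into one kernel-verified Lean document; each statement's English description precedes it below -/
import Mathlib

section
/- Let R be a Noetherian integral domain and let f ∈ R be a prime element. If the localization R[1/f] of R away from f is integrally closed in its fraction field, then R itself is integrally closed in its fraction field. -/
/-- If `z` is integral over `R` and some multiple `z * f ^ n` by a power of a prime element `f`
lies in `R`, then `z` lies in `R`. -/
theorem IsIntegral.exists_algebraMap_eq_of_mul_prime_pow {R A : Type*} [CommRing R] [IsDomain R]
    [CommRing A] [IsDomain A] [Algebra R A] [Module.IsTorsionFree R A] {f : R} (hf : Prime f)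
    {z : A} (hz : IsIntegral R z) (n : ℕ) (a : R)
    (h : z * algebraMap R A (f ^ n) = algebraMap R A a) : ∃ r, algebraMap R A r = z := by
  induction n generalizing a with
  | zero => exact ⟨a, by simpa using h.symm⟩
  | succ n ih =>
    obtain ⟨p, hp, hpz⟩ := hz
    have hdvd := Polynomial.dvd_pow_natDegree_of_aeval_eq_zero hp (f ^ (n + 1)) a z hpz h
    obtain ⟨b, rfl⟩ := hf.dvd_of_dvd_pow ((dvd_pow_self f n.succ_ne_zero).trans hdvd)
    refine ih b (mul_left_cancel₀ (a := algebraMap R A f) ?_ ?_)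
    · exact (map_ne_zero_iff _ (FaithfulSMul.algebraMap_injective R A)).mpr hf.ne_zero
    · rw [← map_mul, ← h, pow_succ, map_mul]
      ring

/-- Descent of normality along a prime element: if `R` is a Noetherian integral domain,
`f ∈ R` is a prime element and the localization `R[1/f]` is integrally closed in its
fraction field, then `R` is integrally closed in its fraction field. -/
theorem normal_of_localization_away_prime
    (R : Type*) [CommRing R] [IsDomain R] [IsNoetherianRing R]
    (f : R) (hf : Prime f)
    (h : IsIntegrallyClosed (Localization.Away f)) :
    IsIntegrallyClosed R := by
  let S := Localization.Away f
  let K := FractionRing R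
  have hM : Submonoid.powers f ≤ nonZeroDivisors R :=
    powers_le_nonZeroDivisors_of_noZeroDivisors hf.ne_zero
  let : Algebra S K :=
    IsLocalization.localizationAlgebraOfSubmonoidLe S K (Submonoid.powers f) (nonZeroDivisors R) hM
  have : IsScalarTower R S K :=
    IsLocalization.localization_isScalarTower_of_submonoid_le S K (Submonoid.powers f)
      (nonZeroDivisors R) hM
  have : IsFractionRing S K :=
    IsFractionRing.isFractionRing_of_isLocalization (Submonoid.powers f) S K hM
  refine (isIntegrallyClosed_iff K).mpr fun {z} hz ↦ ?_
  obtain ⟨y, rfl⟩ := (isIntegrallyClosed_iff K).mp h (hz.tower_top (A := S))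
  obtain ⟨n, a, hy⟩ := IsLocalization.Away.surj f y
  refine hz.exists_algebraMap_eq_of_mul_prime_pow hf n a ?_
  rw [IsScalarTower.algebraMap_apply R S K, IsScalarTower.algebraMap_apply R S K a, ← hy,
    map_mul, map_pow]
end

section
/- Let R be a Noetherian integral domain and let f₁, …, f_r ∈ R be prime elements. If the localization R[1/(f₁⋯f_r)] of R away from the product f₁⋯f_r is integrally closed in its fraction field, then R is integrally closed in its fraction field. -/
/-- In a domain, an element integral over `R` that becomes an element of `R` after multiplication
by a prime of `R` already lies in `R`. -/
theorem IsIntegral.exists_algebraMap_eq_of_prime_mul {R K : Type*} [CommRing R] [IsDomain R]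
    [CommRing K] [IsDomain K] [Algebra R K] [FaithfulSMul R K] {p a : R} {x : K} (hp : Prime p)
    (hx : IsIntegral R x) (h : algebraMap R K p * x = algebraMap R K a) :
    ∃ y, algebraMap R K y = x := by
  obtain ⟨P, hP, hPx⟩ := hx
  obtain ⟨b, rfl⟩ := hp.dvd_of_dvd_pow <|
    Polynomial.dvd_pow_natDegree_of_eval₂_eq_zero (FaithfulSMul.algebraMap_injective R K) hP p a x hPx h
  refine ⟨b, mul_left_cancel₀ ?_ (h.trans (map_mul _ _ _)).symm⟩
  simpa using hp.ne_zero

/-- The elements `s` of `R` such that any element of `K` integral over `R` and multiplied into `R`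
by `s` lies in `R`. -/
def integralDescentSubmonoid (R K : Type*) [CommRing R] [CommRing K] [Algebra R K] :
    Submonoid R where
  carrier := {s | ∀ x : K, IsIntegral R x → (∃ a, algebraMap R K a = algebraMap R K s * x) →
    ∃ y, algebraMap R K y = x}
  one_mem' := by
    intro x _ h
    simpa using h
  mul_mem' := by
    rintro s t hs ht x hx ⟨a, ha⟩
    exact ht x hx (hs _ (isIntegral_algebraMap.mul hx) ⟨a, by rw [ha, map_mul, mul_assoc]⟩)

theorem Prime.mem_integralDescentSubmonoid {R : Type*} (K : Type*) [CommRing R] [IsDomain R]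
    [CommRing K] [IsDomain K] [Algebra R K] [FaithfulSMul R K] {p : R} (hp : Prime p) :
    p ∈ integralDescentSubmonoid R K :=
  fun _ hx ⟨_, ha⟩ => hx.exists_algebraMap_eq_of_prime_mul hp ha.symm

/-- Iterated descent of normality along prime elements: if `R` is a Noetherian integral
domain, `f₁, …, f_r ∈ R` are prime elements and the localization `R[1/(f₁⋯f_r)]` is
integrally closed in its fraction field, then `R` is integrally closed in its fraction
field. -/
theorem normal_of_localization_away_prod_primes
    (R : Type*) [CommRing R] [IsDomain R] [IsNoetherianRing R]
    (r : ℕ) (f : Fin r → R) (hf : ∀ i, Prime (f i))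
    (h : IsIntegrallyClosed (Localization.Away (∏ i, f i))) :
    IsIntegrallyClosed R := by
  have hle : Submonoid.powers (∏ i, f i) ≤ nonZeroDivisors R :=
    powers_le_nonZeroDivisors_of_noZeroDivisors
      (Finset.prod_ne_zero_iff.mpr fun i _ => (hf i).ne_zero)
  let : Algebra (Localization.Away (∏ i, f i)) (FractionRing R) :=
    IsLocalization.localizationAlgebraOfSubmonoidLe _ _ _ _ hle
  have : IsScalarTower R (Localization.Away (∏ i, f i)) (FractionRing R) :=
    IsLocalization.localization_isScalarTower_of_submonoid_le _ _ _ _ hle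
  have : IsFractionRing (Localization.Away (∏ i, f i)) (FractionRing R) :=
    IsFractionRing.isFractionRing_of_isDomain_of_isLocalization
      (Submonoid.powers (∏ i, f i)) _ _
  refine (isIntegrallyClosed_iff (FractionRing R)).mpr fun {x} hx => ?_
  obtain ⟨z, rfl⟩ := (isIntegrallyClosed_iff (FractionRing R)).mp h
    (hx.tower_top (A := Localization.Away (∏ i, f i)))
  obtain ⟨⟨a, s⟩, hs⟩ := IsLocalization.surj (Submonoid.powers (∏ i, f i)) z
  have hmem : Submonoid.powers (∏ i, f i) ≤ integralDescentSubmonoid R (FractionRing R) :=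
    Submonoid.powers_le.mpr <| prod_mem fun i _ =>
      (hf i).mem_integralDescentSubmonoid (FractionRing R)
  refine hmem s.2 _ hx ⟨a, ?_⟩
  simp only [IsScalarTower.algebraMap_apply R (Localization.Away (∏ i, f i)) (FractionRing R),
    ← map_mul, ← hs, mul_comm]
end

section
/- Let φ : ℂ[T₁, T₂, T₃] → ℂ[x, y] be the ℂ-algebra homomorphism determined by φ(T₁) = xy, φ(T₂) = x² + y², φ(T₃) = −x² + y². Then the kernel of φ is the principal ideal generated by the polynomial 4T₁² − T₂² + T₃². -/
open MvPolynomial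

/-- Division with remainder by the quadric `4T₁² − T₂² + T₃²`, viewed as a polynomial in `T₁`. -/
lemma exists_eq_rename_add_mul_quadric (p : MvPolynomial (Fin 3) ℂ) :
    ∃ (A B : MvPolynomial (Fin 2) ℂ) (Q : MvPolynomial (Fin 3) ℂ),
      p = rename Fin.succ A + X 0 * rename Fin.succ B +
        Q * (4 * X 0 ^ 2 - X 1 ^ 2 + X 2 ^ 2) := by
  induction p using MvPolynomial.induction_on with
  | C a => exact ⟨C a, 0, 0, by simp⟩
  | add p q hp hq =>
    obtain ⟨A, B, Q, rfl⟩ := hp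
    obtain ⟨A', B', Q', rfl⟩ := hq
    exact ⟨A + A', B + B', Q + Q', by simp only [map_add]; ring⟩
  | mul_X p i hp =>
    obtain ⟨A, B, Q, rfl⟩ := hp
    fin_cases i
    · have h4 : (4 : MvPolynomial (Fin 3) ℂ) * C (1 / 4) = 1 := by
        rw [show (4 : MvPolynomial (Fin 3) ℂ) = C 4 from (map_ofNat C 4).symm, ← C_mul]
        norm_num
      refine ⟨C (1 / 4) * (X 0 ^ 2 - X 1 ^ 2) * B, A,
        Q * X 0 + C (1 / 4) * rename Fin.succ B, ?_⟩
      simp only [map_mul, map_sub, map_pow, rename_X, rename_C, Fin.zero_eta,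
        Fin.succ_zero_eq_one, Fin.succ_one_eq_two]
      linear_combination (-X 0 ^ 2 * rename Fin.succ B) * h4
    · refine ⟨A * X 0, B * X 0, Q * X 1, ?_⟩
      simp only [map_mul, rename_X, Fin.mk_one, Fin.succ_zero_eq_one]
      ring
    · refine ⟨A * X 1, B * X 1, Q * X 2, ?_⟩
      simp only [map_mul, rename_X, Fin.reduceFinMk, Fin.succ_one_eq_two]
      ring

/-- A polynomial of degree at most one in `T₁` that vanishes after the substitution
`(T₁, T₂, T₃) = (xy, x² + y², −x² + y²)` is zero. -/
lemma eq_zero_of_eval_add_mul_eval_eq_zero {A B : MvPolynomial (Fin 2) ℂ}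
    (h : ∀ x y : ℂ, eval ![x ^ 2 + y ^ 2, -x ^ 2 + y ^ 2] A +
      x * y * eval ![x ^ 2 + y ^ 2, -x ^ 2 + y ^ 2] B = 0) : A = 0 ∧ B = 0 := by
  have key (v : Fin 2 → ℂ) : eval v A = 0 ∧ (v 0 ^ 2 - v 1 ^ 2) * eval v B = 0 := by
    obtain ⟨x, hx⟩ := IsAlgClosed.exists_pow_nat_eq ((v 0 - v 1) / 2) two_pos
    obtain ⟨y, hy⟩ := IsAlgClosed.exists_pow_nat_eq ((v 0 + v 1) / 2) two_pos
    have hv : ![x ^ 2 + y ^ 2, -x ^ 2 + y ^ 2] = v := by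
      ext i
      fin_cases i <;> simp [hx, hy] <;> ring
    have h₁ := h x y
    have h₂ := h (-x) y
    rw [neg_sq, hv] at h₂
    rw [hv] at h₁
    refine ⟨by linear_combination (h₁ + h₂) / 2, ?_⟩
    have hxy : v 0 ^ 2 - v 1 ^ 2 = 4 * (x * y) ^ 2 := by
      rw [mul_pow, hx, hy]
      ring
    rw [hxy]
    linear_combination 2 * x * y * (h₁ - h₂)
  refine ⟨MvPolynomial.funext fun v => by simpa using (key v).1, ?_⟩
  have hB : (X 0 ^ 2 - X 1 ^ 2) * B = 0 :=
    MvPolynomial.funext fun v => by simpa using (key v).2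
  refine (mul_eq_zero.mp hB).resolve_left fun h0 => ?_
  simpa using congrArg (eval ![(1 : ℂ), 0]) h0

/-- The kernel of the `ℂ`-algebra homomorphism `φ : ℂ[T₁,T₂,T₃] → ℂ[x,y]` with
`φ(T₁) = xy`, `φ(T₂) = x² + y²`, `φ(T₃) = −x² + y²` is the principal ideal generated
by `4T₁² − T₂² + T₃²`; this presents the Cox ring of `ℂ²/Q₈`. -/
theorem ker_coxring_Q8 :
    RingHom.ker
      (MvPolynomial.aeval
        ![X 0 * X 1, X 0 ^ 2 + X 1 ^ 2, -X 0 ^ 2 + X 1 ^ 2] :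
        MvPolynomial (Fin 3) ℂ →ₐ[ℂ] MvPolynomial (Fin 2) ℂ) =
      Ideal.span {4 * X 0 ^ 2 - X 1 ^ 2 + X 2 ^ 2} := by
  set φ : MvPolynomial (Fin 3) ℂ →ₐ[ℂ] MvPolynomial (Fin 2) ℂ :=
    aeval ![X 0 * X 1, X 0 ^ 2 + X 1 ^ 2, -X 0 ^ 2 + X 1 ^ 2] with hφ
  have hf : φ (4 * X 0 ^ 2 - X 1 ^ 2 + X 2 ^ 2) = 0 := by
    simp only [hφ, map_add, map_sub, map_mul, map_pow, map_ofNat, aeval_X, Matrix.cons_val]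
    ring
  refine le_antisymm (fun p hp => ?_) ?_
  · obtain ⟨A, B, Q, rfl⟩ := exists_eq_rename_add_mul_quadric p
    rw [RingHom.mem_ker, map_add, map_mul φ Q, hf, mul_zero, add_zero] at hp
    have hren (x y : ℂ) (P : MvPolynomial (Fin 2) ℂ) :
        eval ![x, y] (φ (rename Fin.succ P)) =
          eval ![x ^ 2 + y ^ 2, -x ^ 2 + y ^ 2] P := by
      rw [hφ, aeval_rename]
      induction P using MvPolynomial.induction_on with
      | C a => simp
      | add p q hp hq => simp only [map_add, hp, hq]
      | mul_X p i hp =>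
        rw [map_mul, map_mul, map_mul, hp]
        fin_cases i <;> simp
    obtain ⟨rfl, rfl⟩ := eq_zero_of_eval_add_mul_eval_eq_zero (A := A) (B := B) fun x y => by
      have h := congrArg (eval ![x, y]) hp
      rw [map_add, map_mul, map_add, map_mul, hren, hren] at h
      simpa [hφ] using h
    simpa using Ideal.mul_mem_left _ Q (Ideal.mem_span_singleton_self _)
  · rw [Ideal.span_singleton_le_iff_mem]
    exact hf
end

section
/- Let ζ be a primitive third root of unity in ℂ and let φ : ℂ[T₁, T₂, T₃, T₄] → ℂ[x, y, z] be the ℂ-algebra homomorphism determined by φ(T₁) = x³ − y³, φ(T₂) = x³ + y³, φ(T₃) = z, φ(T₄) = xy. Then the kernel of φ is the principal ideal generated by the polynomial 4T₄³ + T₁² − T₂². Moreover, the image of φ equals the subalgebra of ℂ[x, y, z] invariant under the ℂ-algebra automorphism determined by x ↦ ζx, y ↦ ζ²y, z ↦ z. -/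
open MvPolynomial

namespace CoxRingOrderThree

variable {R A : Type*} [CommRing R] [CommRing A] [Algebra R A]

theorem monomial_fin_three (m : Fin 3 →₀ ℕ) (a : R) :
    monomial m a = C a * (X 0 ^ m 0 * X 1 ^ m 1 * X 2 ^ m 2) := by
  rw [monomial_eq, Finsupp.prod_fintype _ _ (by simp), Fin.prod_univ_three]

/-- The `R`-linear map sending `x ^ i * y ^ j * z ^ k` with `i ≡ j` modulo `3` to
`u ^ (i / 3) * v ^ (j / 3) * z ^ k * w ^ (i % 3)`, and all other monomials to `0`. -/
noncomputable def invariantLift (R : Type*) {A : Type*} [CommRing R] [CommRing A] [Algebra R A]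
    (u v z w : A) : MvPolynomial (Fin 3) R →ₗ[R] A :=
  (basisMonomials (Fin 3) R).constr R fun m =>
    if m 0 % 3 = m 1 % 3 then u ^ (m 0 / 3) * v ^ (m 1 / 3) * z ^ m 2 * w ^ (m 0 % 3) else 0

theorem invariantLift_X_pow (u v z w : A) (i j k : ℕ) :
    invariantLift R u v z w (X 0 ^ i * X 1 ^ j * X 2 ^ k) =
      if i % 3 = j % 3 then u ^ (i / 3) * v ^ (j / 3) * z ^ k * w ^ (i % 3) else 0 := by
  let m : Fin 3 →₀ ℕ := Finsupp.equivFunOnFinite.symm ![i, j, k]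
  have h : (X 0 ^ i * X 1 ^ j * X 2 ^ k : MvPolynomial (Fin 3) R) =
      basisMonomials (Fin 3) R m := by
    simp [coe_basisMonomials, monomial_fin_three, m]
  rw [h, invariantLift, Module.Basis.constr_basis]
  simp [m]

/-- Two linear maps out of `R[x, y, z]` agreeing on monomials are equal. -/
theorem linearMap_ext_X_pow {f g : MvPolynomial (Fin 3) R →ₗ[R] A}
    (h : ∀ i j k, f (X 0 ^ i * X 1 ^ j * X 2 ^ k) = g (X 0 ^ i * X 1 ^ j * X 2 ^ k))
    (q : MvPolynomial (Fin 3) R) : f q = g q := by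
  induction q using MvPolynomial.induction_on' with
  | monomial m a => rw [monomial_fin_three, ← smul_eq_C_mul, map_smul, map_smul, h]
  | add p q hp hq => rw [map_add, map_add, hp, hq]

theorem invariantLift_mul_of_X_pow {u v z w a : A} {b : MvPolynomial (Fin 3) R}
    (h : ∀ i j k, invariantLift R u v z w (X 0 ^ i * X 1 ^ j * X 2 ^ k * b) =
      invariantLift R u v z w (X 0 ^ i * X 1 ^ j * X 2 ^ k) * a) (q : MvPolynomial (Fin 3) R) :
    invariantLift R u v z w (q * b) = invariantLift R u v z w q * a :=
  linearMap_ext_X_pow (f := invariantLift R u v z w ∘ₗ LinearMap.mulRight R b)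
    (g := LinearMap.mulRight R a ∘ₗ invariantLift R u v z w) h q

theorem invariantLift_mul_X_zero_pow (u v z w : A) (q : MvPolynomial (Fin 3) R) :
    invariantLift R u v z w (q * X 0 ^ 3) = invariantLift R u v z w q * u := by
  refine invariantLift_mul_of_X_pow (fun i j k => ?_) q
  rw [show (X 0 ^ i * X 1 ^ j * X 2 ^ k * X 0 ^ 3 : MvPolynomial (Fin 3) R) =
    X 0 ^ (i + 3) * X 1 ^ j * X 2 ^ k by ring, invariantLift_X_pow, invariantLift_X_pow,
    Nat.add_mod_right, Nat.add_div_right _ (by norm_num), ite_mul, zero_mul]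
  congr 1
  ring

theorem invariantLift_mul_X_one_pow (u v z w : A) (q : MvPolynomial (Fin 3) R) :
    invariantLift R u v z w (q * X 1 ^ 3) = invariantLift R u v z w q * v := by
  refine invariantLift_mul_of_X_pow (fun i j k => ?_) q
  rw [show (X 0 ^ i * X 1 ^ j * X 2 ^ k * X 1 ^ 3 : MvPolynomial (Fin 3) R) =
    X 0 ^ i * X 1 ^ (j + 3) * X 2 ^ k by ring, invariantLift_X_pow, invariantLift_X_pow,
    Nat.add_mod_right, Nat.add_div_right _ (by norm_num), ite_mul, zero_mul]
  congr 1
  ring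

theorem invariantLift_mul_X_two (u v z w : A) (q : MvPolynomial (Fin 3) R) :
    invariantLift R u v z w (q * X 2) = invariantLift R u v z w q * z := by
  refine invariantLift_mul_of_X_pow (fun i j k => ?_) q
  rw [mul_assoc, ← pow_succ, invariantLift_X_pow, invariantLift_X_pow, ite_mul, zero_mul]
  congr 1
  ring

theorem invariantLift_mul_X_mul_X {u v w : A} (z : A) (h : w ^ 3 = u * v)
    (q : MvPolynomial (Fin 3) R) :
    invariantLift R u v z w (q * (X 0 * X 1)) = invariantLift R u v z w q * w := by
  refine invariantLift_mul_of_X_pow (fun i j k => ?_) q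
  rw [show (X 0 ^ i * X 1 ^ j * X 2 ^ k * (X 0 * X 1) : MvPolynomial (Fin 3) R) =
    X 0 ^ (i + 1) * X 1 ^ (j + 1) * X 2 ^ k by ring, invariantLift_X_pow, invariantLift_X_pow]
  by_cases hij : i % 3 = j % 3
  · rw [if_pos hij, if_pos (by omega)]
    by_cases hi : i % 3 = 2
    · rw [show (i + 1) / 3 = i / 3 + 1 by omega, show (j + 1) / 3 = j / 3 + 1 by omega,
        show (i + 1) % 3 = 0 by omega, hi]
      linear_combination -(u ^ (i / 3) * v ^ (j / 3) * z ^ k) * h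
    · rw [show (i + 1) / 3 = i / 3 by omega, show (j + 1) / 3 = j / 3 by omega,
        show (i + 1) % 3 = i % 3 + 1 by omega]
      ring
  · rw [if_neg hij, if_neg (by omega), zero_mul]

theorem coeff_aeval_scale (ζ : R) (p : MvPolynomial (Fin 3) R) (m : Fin 3 →₀ ℕ) :
    coeff m (aeval ![C ζ * X 0, C (ζ ^ 2) * X 1, X 2] p : MvPolynomial (Fin 3) R) =
      ζ ^ (m 0 + 2 * m 1) * coeff m p := by
  induction p using MvPolynomial.induction_on' with
  | monomial n a =>
    have h : (aeval ![C ζ * X 0, C (ζ ^ 2) * X 1, X 2] (monomial n a) :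
        MvPolynomial (Fin 3) R) = C (ζ ^ (n 0 + 2 * n 1)) * monomial n a := by
      simp only [monomial_fin_three, map_mul, map_pow, aeval_X, aeval_C, algebraMap_eq,
        Matrix.cons_val]
      ring
    rw [h, coeff_C_mul, coeff_monomial]
    split_ifs with hnm
    · rw [hnm]
    · simp
  | add p q hp hq => rw [map_add, coeff_add, coeff_add, hp, hq, mul_add]

theorem mod_three_eq_of_pow_eq_one {ζ : R} (hζ3 : ζ ^ 3 = 1) (hζ1 : ζ ≠ 1) {i j : ℕ}
    (h : ζ ^ (i + 2 * j) = 1) : i % 3 = j % 3 := by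
  have := orderOf_dvd_of_pow_eq_one h
  rw [orderOf_eq_prime hζ3 hζ1] at this
  omega

end CoxRingOrderThree

open CoxRingOrderThree in
/-- Let `ζ` be a primitive third root of unity and `φ : ℂ[T₁,…,T₄] → ℂ[x,y,z]` the
`ℂ`-algebra homomorphism with `φ(T₁) = x³ − y³`, `φ(T₂) = x³ + y³`, `φ(T₃) = z`,
`φ(T₄) = xy`. Then `ker φ = ⟨4T₄³ + T₁² − T₂²⟩` and the image of `φ` is the ring of
invariants of the automorphism `x ↦ ζx, y ↦ ζ²y, z ↦ z`. -/
theorem ker_and_range_coxring_order3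
    (ζ : ℂ) (hζ3 : ζ ^ 3 = 1) (hζ1 : ζ ≠ 1) :
    RingHom.ker
      (MvPolynomial.aeval
        ![X 0 ^ 3 - X 1 ^ 3, X 0 ^ 3 + X 1 ^ 3, X 2, X 0 * X 1] :
        MvPolynomial (Fin 4) ℂ →ₐ[ℂ] MvPolynomial (Fin 3) ℂ) =
      Ideal.span {4 * X 3 ^ 3 + X 0 ^ 2 - X 1 ^ 2} ∧
    ((MvPolynomial.aeval
        ![X 0 ^ 3 - X 1 ^ 3, X 0 ^ 3 + X 1 ^ 3, X 2, X 0 * X 1] :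
        MvPolynomial (Fin 4) ℂ →ₐ[ℂ] MvPolynomial (Fin 3) ℂ).range : Set (MvPolynomial (Fin 3) ℂ)) =
      {p : MvPolynomial (Fin 3) ℂ |
        MvPolynomial.aeval ![C ζ * X 0, C (ζ ^ 2) * X 1, X 2] p = p} := by
  set φ : MvPolynomial (Fin 4) ℂ →ₐ[ℂ] MvPolynomial (Fin 3) ℂ :=
    aeval ![X 0 ^ 3 - X 1 ^ 3, X 0 ^ 3 + X 1 ^ 3, X 2, X 0 * X 1] with hφ
  have h0 : φ (X 0) = X 0 ^ 3 - X 1 ^ 3 := by simp [hφ]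
  have h1 : φ (X 1) = X 0 ^ 3 + X 1 ^ 3 := by simp [hφ]
  have h2 : φ (X 2) = X 2 := by simp [hφ]
  have h3 : φ (X 3) = X 0 * X 1 := by simp [hφ]
  have half (σ : Type) : (C (1 / 2) * 2 : MvPolynomial σ ℂ) = 1 := by
    rw [← map_ofNat C 2, ← C_mul]
    norm_num
  refine ⟨le_antisymm (fun p hp => ?_) ?_, Set.Subset.antisymm ?_ fun p hp => ?_⟩
  · set I : Ideal (MvPolynomial (Fin 4) ℂ) := Ideal.span {4 * X 3 ^ 3 + X 0 ^ 2 - X 1 ^ 2}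
    let π := Ideal.Quotient.mkₐ ℂ I
    let u := π (C (1 / 2) * (X 1 + X 0))
    let v := π (C (1 / 2) * (X 1 - X 0))
    have hu : u - v = π (X 0) := by
      rw [← map_sub]
      congr 1
      linear_combination X 0 * half (Fin 4)
    have hv : u + v = π (X 1) := by
      rw [← map_add]
      congr 1
      linear_combination X 1 * half (Fin 4)
    have hw : π (X 3) ^ 3 = u * v := by
      rw [← map_pow, ← map_mul]
      refine Ideal.Quotient.eq.2 (Ideal.mem_span_singleton.2 ⟨C (1 / 2) ^ 2, ?_⟩)
      linear_combination -(X 3 ^ 3) * (C (1 / 2) * 2 + 1) * half (Fin 4)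
    have key (q : MvPolynomial (Fin 4) ℂ) :
        invariantLift ℂ u v (π (X 2)) (π (X 3)) (φ q) = π q := by
      induction q using MvPolynomial.induction_on with
      | C a =>
        have h := invariantLift_X_pow (R := ℂ) u v (π (X 2)) (π (X 3)) 0 0 0
        simp only [pow_zero, mul_one, Nat.zero_mod, Nat.zero_div, if_true] at h
        rw [← algebraMap_eq, AlgHom.commutes, AlgHom.commutes, Algebra.algebraMap_eq_smul_one,
          map_smul, h, Algebra.algebraMap_eq_smul_one]
      | add p q hp hq => rw [map_add, map_add, map_add, hp, hq]
      | mul_X p i hp =>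
        rw [map_mul φ, map_mul π, ← hp]
        fin_cases i
        · change invariantLift _ _ _ _ _ (φ p * φ (X 0)) = _ * π (X 0)
          rw [h0, mul_sub, map_sub, invariantLift_mul_X_zero_pow, invariantLift_mul_X_one_pow,
            ← hu, mul_sub]
        · change invariantLift _ _ _ _ _ (φ p * φ (X 1)) = _ * π (X 1)
          rw [h1, mul_add, map_add, invariantLift_mul_X_zero_pow, invariantLift_mul_X_one_pow,
            ← hv, mul_add]
        · change invariantLift _ _ _ _ _ (φ p * φ (X 2)) = _ * π (X 2)
          rw [h2, invariantLift_mul_X_two]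
        · change invariantLift _ _ _ _ _ (φ p * φ (X 3)) = _ * π (X 3)
          rw [h3, invariantLift_mul_X_mul_X _ hw]
    refine Ideal.Quotient.eq_zero_iff_mem.1 ((key p).symm.trans ?_)
    rw [RingHom.mem_ker.1 hp, map_zero]
  · rw [Ideal.span_singleton_le_iff_mem, RingHom.mem_ker]
    simp only [map_add, map_sub, map_mul, map_pow, map_ofNat, h0, h1, h3]
    ring
  · rintro _ ⟨q, rfl⟩
    have hC : (C ζ ^ 3 : MvPolynomial (Fin 3) ℂ) = 1 := by rw [← C_pow, hζ3, C_1]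
    have h : (aeval ![C ζ * X 0, C (ζ ^ 2) * X 1, X 2]).comp φ = φ := by
      ext1 i
      fin_cases i
      · simp [hφ, mul_pow, ← pow_mul, pow_mul' (C ζ : MvPolynomial (Fin 3) ℂ) 2 3, hC]
      · simp [hφ, mul_pow, ← pow_mul, pow_mul' (C ζ : MvPolynomial (Fin 3) ℂ) 2 3, hC]
      · simp [hφ]
      · suffices h : C ζ * X 0 * (C ζ ^ 2 * X 1) = (X 0 * X 1 : MvPolynomial (Fin 3) ℂ) by
          simpa [hφ] using h
        linear_combination X 0 * X 1 * hC
    exact DFunLike.congr_fun h q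
  · rw [SetLike.mem_coe, p.as_sum]
    refine Subalgebra.sum_mem _ fun m hm => ?_
    have hm' : m 0 % 3 = m 1 % 3 := by
      refine mod_three_eq_of_pow_eq_one hζ3 hζ1 (mul_right_cancel₀ (mem_support_iff.1 hm) ?_)
      rw [← coeff_aeval_scale, hp, one_mul]
    refine ⟨C (coeff m p) * ((C (1 / 2) * (X 1 + X 0)) ^ (m 0 / 3) *
      (C (1 / 2) * (X 1 - X 0)) ^ (m 1 / 3) * X 2 ^ m 2 * X 3 ^ (m 0 % 3)), ?_⟩
    have hC (a : ℂ) : φ (C a) = C a := φ.commutes a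
    have hu : C (1 / 2) * (X 0 ^ 3 + X 1 ^ 3 + (X 0 ^ 3 - X 1 ^ 3)) =
        (X 0 ^ 3 : MvPolynomial (Fin 3) ℂ) := by
      linear_combination X 0 ^ 3 * half (Fin 3)
    have hv : C (1 / 2) * (X 0 ^ 3 + X 1 ^ 3 - (X 0 ^ 3 - X 1 ^ 3)) =
        (X 1 ^ 3 : MvPolynomial (Fin 3) ℂ) := by
      linear_combination X 1 ^ 3 * half (Fin 3)
    change φ _ = _
    simp only [map_mul, map_pow, map_add, map_sub, h0, h1, h2, h3, hC, hu, hv]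
    rw [monomial_fin_three]
    have e0 : m 0 = 3 * (m 0 / 3) + m 0 % 3 := by omega
    have e1 : m 1 = 3 * (m 1 / 3) + m 0 % 3 := by omega
    conv_rhs => rw [e0, e1]
    ring
end

section
/- Let ζ be a primitive fifth root of unity in ℂ and let φ : ℂ[T₁, T₂, T₃, T₄] → ℂ[x, y, z] be the ℂ-algebra homomorphism determined by φ(T₁) = z, φ(T₂) = x⁵ − y⁵, φ(T₃) = xy, φ(T₄) = x⁵ + y⁵. Then the kernel of φ is the principal ideal generated by the polynomial 4T₃⁵ + T₂² − T₄². Moreover, the image of φ equals the subalgebra of ℂ[x, y, z] invariant under the ℂ-algebra automorphism determined by x ↦ ζx, y ↦ ζ⁴y, z ↦ z. -/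
open MvPolynomial

theorem MvPolynomial.monomial_fin_three {R : Type*} [CommSemiring R] (m : Fin 3 →₀ ℕ) (a : R) :
    monomial m a = C a * (X 0 ^ m 0 * X 1 ^ m 1 * X 2 ^ m 2) := by
  rw [monomial_eq, Finsupp.prod_fintype _ _ (by simp), Fin.prod_univ_three]

theorem MvPolynomial.coeff_aeval_C_mul_X {R σ : Type*} [CommSemiring R] [Fintype σ]
    (c : σ → R) (p : MvPolynomial σ R) (m : σ →₀ ℕ) :
    coeff m (aeval (fun i => C (c i) * X i) p) = (∏ i, c i ^ m i) * coeff m p := by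
  classical
  induction p using MvPolynomial.induction_on' with
  | monomial u a =>
    have h : aeval (fun i => C (c i) * X i) (monomial u a) =
        C (∏ i, c i ^ u i) * monomial u a := by
      rw [aeval_monomial, Finsupp.prod_fintype _ _ (by simp), monomial_eq,
        Finsupp.prod_fintype _ _ (by simp), algebraMap_eq, map_prod]
      simp only [mul_pow, Finset.prod_mul_distrib, map_pow]
      ring
    rw [h, coeff_C_mul, coeff_monomial]
    split_ifs with hu
    · rw [hu]
    · simp
  | add p q hp hq => simp only [map_add, coeff_add, hp, hq, mul_add]

namespace CoxRingOrderFive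

/-- The homomorphism `T₁ ↦ z, T₂ ↦ x⁵ - y⁵, T₃ ↦ xy, T₄ ↦ x⁵ + y⁵`. -/
noncomputable abbrev invariantMap : MvPolynomial (Fin 4) ℂ →ₐ[ℂ] MvPolynomial (Fin 3) ℂ :=
  aeval ![X 2, X 0 ^ 5 - X 1 ^ 5, X 0 * X 1, X 0 ^ 5 + X 1 ^ 5]

/-- A preimage of `x⁵` under `invariantMap`. -/
noncomputable def liftX : MvPolynomial (Fin 4) ℂ := C (1 / 2) * (X 3 + X 1)

/-- A preimage of `y⁵` under `invariantMap`. -/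
noncomputable def liftY : MvPolynomial (Fin 4) ℂ := C (1 / 2) * (X 3 - X 1)

theorem C_half_mul_two {σ : Type*} : (C (1 / 2) * 2 : MvPolynomial σ ℂ) = 1 := by
  rw [← map_ofNat (C : ℂ →+* MvPolynomial σ ℂ) 2, ← C_mul]
  norm_num

theorem liftX_add_liftY : liftX + liftY = X 3 := by
  unfold liftX liftY
  linear_combination X 3 * C_half_mul_two (σ := Fin 4)

theorem liftX_sub_liftY : liftX - liftY = X 1 := by
  unfold liftX liftY
  linear_combination X 1 * C_half_mul_two (σ := Fin 4)

theorem invariantMap_liftX : invariantMap liftX = X 0 ^ 5 := by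
  simp only [liftX, map_mul, map_add, aeval_X, algHom_C, algebraMap_eq, Matrix.cons_val]
  linear_combination X 0 ^ 5 * C_half_mul_two (σ := Fin 3)

theorem invariantMap_liftY : invariantMap liftY = X 1 ^ 5 := by
  simp only [liftY, map_mul, map_sub, aeval_X, algHom_C, algebraMap_eq, Matrix.cons_val]
  linear_combination X 1 ^ 5 * C_half_mul_two (σ := Fin 3)

/-- The linear map sending `xᵃyᵇzᶜ` with `a ≡ b [MOD 5]` to a preimage of it under
`invariantMap`. -/
noncomputable def linearSection : MvPolynomial (Fin 3) ℂ →ₗ[ℂ] MvPolynomial (Fin 4) ℂ :=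
  (basisMonomials (Fin 3) ℂ).constr ℂ fun m =>
    X 0 ^ m 2 * X 2 ^ (m 0 % 5) * liftX ^ (m 0 / 5) * liftY ^ (m 1 / 5)

theorem linearSection_monomial (m : Fin 3 →₀ ℕ) (a : ℂ) :
    linearSection (monomial m a) =
      C a * (X 0 ^ m 2 * X 2 ^ (m 0 % 5) * liftX ^ (m 0 / 5) * liftY ^ (m 1 / 5)) := by
  have h := (basisMonomials (Fin 3) ℂ).constr_basis ℂ (fun m : Fin 3 →₀ ℕ =>
    X 0 ^ m 2 * X 2 ^ (m 0 % 5) * liftX ^ (m 0 / 5) * liftY ^ (m 1 / 5)) m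
  rw [coe_basisMonomials] at h
  rw [← mul_one a, ← smul_eq_mul, ← smul_monomial, map_smul, linearSection, h, smul_eq_mul,
    mul_one, smul_eq_C_mul]

theorem linearSection_C_mul (a : ℂ) (i j k : ℕ) :
    linearSection (C a * (X 0 ^ i * X 1 ^ j * X 2 ^ k)) =
      C a * (X 0 ^ k * X 2 ^ (i % 5) * liftX ^ (i / 5) * liftY ^ (j / 5)) := by
  have h := monomial_fin_three (Finsupp.equivFunOnFinite.symm ![i, j, k]) a
  have h' := linearSection_monomial (Finsupp.equivFunOnFinite.symm ![i, j, k]) a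
  simp only [Finsupp.equivFunOnFinite_symm_apply_apply, Matrix.cons_val] at h h'
  rw [← h, h']

theorem invariantMap_linearSection_monomial {m : Fin 3 →₀ ℕ} (hm : m 0 % 5 = m 1 % 5) (a : ℂ) :
    invariantMap (linearSection (monomial m a)) = monomial m a := by
  rw [linearSection_monomial, monomial_fin_three]
  simp only [map_mul, map_pow, invariantMap_liftX, invariantMap_liftY]
  simp only [aeval_X, algHom_C, algebraMap_eq, Matrix.cons_val]
  have h0 : (X 0 : MvPolynomial (Fin 3) ℂ) ^ m 0 = X 0 ^ (m 0 % 5) * (X 0 ^ 5) ^ (m 0 / 5) := by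
    rw [← pow_mul, ← pow_add, Nat.mod_add_div]
  have h1 : (X 1 : MvPolynomial (Fin 3) ℂ) ^ m 1 = X 1 ^ (m 0 % 5) * (X 1 ^ 5) ^ (m 1 / 5) := by
    rw [hm, ← pow_mul, ← pow_add, Nat.mod_add_div]
  rw [h0, h1]
  ring

/-- The ideal generated by `4T₃⁵ + T₂² - T₄²`. -/
noncomputable abbrev relationIdeal : Ideal (MvPolynomial (Fin 4) ℂ) :=
  Ideal.span {4 * X 2 ^ 5 + X 1 ^ 2 - X 3 ^ 2}

theorem mk_liftX_mul_liftY :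
    Ideal.Quotient.mk relationIdeal liftX * Ideal.Quotient.mk relationIdeal liftY =
      Ideal.Quotient.mk relationIdeal (X 2) ^ 5 := by
  rw [← map_mul, ← map_pow, Ideal.Quotient.eq, Ideal.mem_span_singleton]
  refine ⟨-C (1 / 2) ^ 2, ?_⟩
  unfold liftX liftY
  linear_combination (X 2 ^ 5 * (C (1 / 2) * 2 + 1)) * C_half_mul_two (σ := Fin 4)

/-- The change of variables replacing `T₂` and `T₄` by the preimages of `x⁵` and `y⁵`. -/
noncomputable def diagonalize : MvPolynomial (Fin 4) ℂ →ₐ[ℂ] MvPolynomial (Fin 4) ℂ :=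
  aeval ![X 0, liftX, X 2, liftY]

theorem diagonalize_surjective : Function.Surjective diagonalize := by
  have h : diagonalize.comp (aeval ![X 0, X 1 - X 3, X 2, X 1 + X 3]) = AlgHom.id ℂ _ := by
    ext1 i
    fin_cases i <;> simp [diagonalize, liftX_add_liftY, liftX_sub_liftY]
  exact fun p => ⟨_, DFunLike.congr_fun h p⟩

theorem mk_linearSection_invariantMap (p : MvPolynomial (Fin 4) ℂ) :
    Ideal.Quotient.mk relationIdeal (linearSection (invariantMap p)) =
      Ideal.Quotient.mk relationIdeal p := by
  obtain ⟨q, rfl⟩ := diagonalize_surjective p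
  induction q using MvPolynomial.induction_on' with
  | add p q hp hq => simp only [map_add, hp, hq]
  | monomial u a =>
    have hd : diagonalize (monomial u a) =
        C a * (X 0 ^ u 0 * liftX ^ u 1 * X 2 ^ u 2 * liftY ^ u 3) := by
      rw [diagonalize, aeval_monomial, Finsupp.prod_fintype _ _ (by simp), Fin.prod_univ_four]
      rfl
    have hi : invariantMap (diagonalize (monomial u a)) =
        C a * (X 0 ^ (u 2 + 5 * u 1) * X 1 ^ (u 2 + 5 * u 3) * X 2 ^ u 0) := by
      rw [hd]
      simp only [map_mul, map_pow, invariantMap_liftX, invariantMap_liftY]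
      simp only [aeval_X, algHom_C, algebraMap_eq, Matrix.cons_val]
      ring
    have hX : (X 2 : MvPolynomial (Fin 4) ℂ) ^ u 2 = X 2 ^ (u 2 % 5) * (X 2 ^ 5) ^ (u 2 / 5) := by
      rw [← pow_mul, ← pow_add, Nat.mod_add_div]
    rw [hi, hd, linearSection_C_mul, Nat.add_mul_mod_self_left, Nat.add_mul_div_left _ _ (by simp),
      Nat.add_mul_div_left _ _ (by simp), hX]
    simp only [map_mul, map_pow, ← mk_liftX_mul_liftY]
    ring

theorem ker_invariantMap : RingHom.ker invariantMap = relationIdeal := by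
  apply le_antisymm
  · intro p hp
    rw [RingHom.mem_ker] at hp
    rw [← Ideal.Quotient.eq_zero_iff_mem, ← mk_linearSection_invariantMap, hp, map_zero, map_zero]
  · rw [Ideal.span_singleton_le_iff_mem, RingHom.mem_ker]
    simp only [map_sub, map_add, map_mul, map_pow, map_ofNat, aeval_X, Matrix.cons_val]
    ring

theorem range_invariantMap {ζ : ℂ} (hζ : IsPrimitiveRoot ζ 5) :
    (invariantMap.range : Set (MvPolynomial (Fin 3) ℂ)) =
      {p | aeval ![C ζ * X 0, C (ζ ^ 4) * X 1, X 2] p = p} := by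
  ext p
  simp only [SetLike.mem_coe, Set.mem_ofPred_eq]
  constructor
  · rintro ⟨q, rfl⟩
    have hC : (C ζ : MvPolynomial (Fin 3) ℂ) ^ 5 = 1 := by rw [← C_pow, hζ.pow_eq_one, C_1]
    suffices h : (aeval ![C ζ * X 0, C (ζ ^ 4) * X 1, X 2]).comp invariantMap = invariantMap from
      DFunLike.congr_fun h q
    ext1 i
    fin_cases i <;> simp [mul_pow, ← pow_mul, hC, pow_mul' _ 4 5]
    linear_combination (X 0 * X 1) * hC
  · intro hp
    have hfun : (![C ζ * X 0, C (ζ ^ 4) * X 1, X 2] : Fin 3 → MvPolynomial (Fin 3) ℂ) =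
        fun i => C (![ζ, ζ ^ 4, 1] i) * X i := by
      funext i
      fin_cases i <;> simp
    rw [hfun] at hp
    rw [p.as_sum]
    refine sum_mem fun m hm => ⟨_, invariantMap_linearSection_monomial ?_ _⟩
    have hc := coeff_aeval_C_mul_X ![ζ, ζ ^ 4, 1] p m
    rw [hp, eq_comm, mul_eq_right₀ (mem_support_iff.mp hm), Fin.prod_univ_three] at hc
    simp only [Matrix.cons_val, one_pow, mul_one, ← pow_mul, ← pow_add] at hc
    have := hζ.dvd_of_pow_eq_one _ hc
    omega

end CoxRingOrderFive

/-- Let `ζ` be a primitive fifth root of unity and `φ : ℂ[T₁,…,T₄] → ℂ[x,y,z]` the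
`ℂ`-algebra homomorphism with `φ(T₁) = z`, `φ(T₂) = x⁵ − y⁵`, `φ(T₃) = xy`,
`φ(T₄) = x⁵ + y⁵`. Then `ker φ = ⟨4T₃⁵ + T₂² − T₄²⟩` and the image of `φ` is the ring
of invariants of the automorphism `x ↦ ζx, y ↦ ζ⁴y, z ↦ z`. -/
theorem ker_and_range_coxring_order5
    (ζ : ℂ) (hζ5 : ζ ^ 5 = 1) (hζ1 : ζ ≠ 1) :
    RingHom.ker
      (MvPolynomial.aeval
        ![X 2, X 0 ^ 5 - X 1 ^ 5, X 0 * X 1, X 0 ^ 5 + X 1 ^ 5] :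
        MvPolynomial (Fin 4) ℂ →ₐ[ℂ] MvPolynomial (Fin 3) ℂ) =
      Ideal.span {4 * X 2 ^ 5 + X 1 ^ 2 - X 3 ^ 2} ∧
    ((MvPolynomial.aeval
        ![X 2, X 0 ^ 5 - X 1 ^ 5, X 0 * X 1, X 0 ^ 5 + X 1 ^ 5] :
        MvPolynomial (Fin 4) ℂ →ₐ[ℂ] MvPolynomial (Fin 3) ℂ).range : Set (MvPolynomial (Fin 3) ℂ)) =
      {p : MvPolynomial (Fin 3) ℂ |
        MvPolynomial.aeval ![C ζ * X 0, C (ζ ^ 4) * X 1, X 2] p = p} := by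
  have : Fact (Nat.Prime 5) := ⟨Nat.prime_five⟩
  exact ⟨CoxRingOrderFive.ker_invariantMap, CoxRingOrderFive.range_invariantMap
    (IsPrimitiveRoot.iff_orderOf.mpr (orderOf_eq_prime hζ5 hζ1))⟩
end

section
/- Let φ : ℂ[T₁, T₂, T₃, T₄] → ℂ[x, y, z] be the ℂ-algebra homomorphism determined by φ(T₁) = xy, φ(T₂) = x² − y², φ(T₃) = z, φ(T₄) = x² + y². Then the kernel of φ is the principal ideal generated by the polynomial 4T₁² + T₂² − T₄². Moreover, the image of φ equals the subalgebra of ℂ[x, y, z] invariant under the ℂ-algebra automorphism determined by x ↦ −x, y ↦ −y, z ↦ z. -/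
open MvPolynomial

/-- Modulo `4T₁² + T₂² − T₄²`, every polynomial in `T₁, …, T₄` is of degree at most one in `T₁`. -/
theorem exists_sub_rename_add_mem_span (p : MvPolynomial (Fin 4) ℂ) :
    ∃ a b : MvPolynomial (Fin 3) ℂ,
      p - (rename Fin.succ a + X 0 * rename Fin.succ b) ∈
        Ideal.span {(4 * X 0 ^ 2 + X 1 ^ 2 - X 3 ^ 2 : MvPolynomial (Fin 4) ℂ)} := by
  simp only [Ideal.mem_span_singleton']
  induction p using MvPolynomial.induction_on with
  | C r => exact ⟨C r, 0, 0, by simp⟩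
  | add p q hp hq =>
    obtain ⟨a, b, k, h⟩ := hp
    obtain ⟨a', b', k', h'⟩ := hq
    refine ⟨a + a', b + b', k + k', ?_⟩
    simp only [map_add]
    linear_combination h + h'
  | mul_X p i hp =>
    obtain ⟨a, b, k, h⟩ := hp
    refine Fin.cases ?_ (fun j => ?_) i
    · refine ⟨C (1 / 4) * (X 2 ^ 2 - X 0 ^ 2) * b, a, k * X 0 + C (1 / 4) * rename Fin.succ b, ?_⟩
      have hC : (C (1 / 4) : MvPolynomial (Fin 4) ℂ) * 4 = 1 := by
        rw [← map_ofNat (C : ℂ →+* MvPolynomial (Fin 4) ℂ) 4, ← C_mul]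
        norm_num
      simp only [map_mul, map_sub, map_pow, rename_X, rename_C, Fin.succ_zero_eq_one,
        show Fin.succ (2 : Fin 3) = 3 from rfl]
      linear_combination X 0 * h + X 0 ^ 2 * rename Fin.succ b * hC
    · refine ⟨a * X j, b * X j, k * X j.succ, ?_⟩
      simp only [map_mul, rename_X]
      linear_combination X j.succ * h

/-- The polynomials `x² − y²`, `z`, `x² + y²` are algebraically independent. -/
theorem algebraicIndependent_sq_sub_sq_sq_add_sq :
    AlgebraicIndependent ℂ
      (![X 0 ^ 2 - X 1 ^ 2, X 2, X 0 ^ 2 + X 1 ^ 2] : Fin 3 → MvPolynomial (Fin 3) ℂ) := by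
  rw [algebraicIndependent_iff]
  intro p hp
  refine MvPolynomial.funext fun v => ?_
  obtain ⟨s, hs⟩ := IsAlgClosed.exists_pow_nat_eq ((v 2 + v 0) / 2) two_pos
  obtain ⟨t, ht⟩ := IsAlgClosed.exists_pow_nat_eq ((v 2 - v 0) / 2) two_pos
  have h := congrArg (aeval ![s, t, v 1]) hp
  rw [map_zero, ← AlgHom.comp_apply, comp_aeval] at h
  rw [map_zero, ← h, ← aeval_eq_eval]
  congr 2
  funext i
  fin_cases i <;> simp [hs, ht] <;> ring

/-- Every polynomial in `x, y, z` is a combination of `1, x, y` over any subalgebra containing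
`xy, x², y², z`. -/
theorem exists_eq_add_X_mul_add_X_mul (S : Subalgebra ℂ (MvPolynomial (Fin 3) ℂ))
    (hxy : X 0 * X 1 ∈ S) (hx : X 0 ^ 2 ∈ S) (hy : X 1 ^ 2 ∈ S) (hz : X 2 ∈ S)
    (p : MvPolynomial (Fin 3) ℂ) :
    ∃ a ∈ S, ∃ b ∈ S, ∃ c ∈ S, p = a + X 0 * b + X 1 * c := by
  induction p using MvPolynomial.induction_on with
  | C r => exact ⟨C r, S.algebraMap_mem r, 0, S.zero_mem, 0, S.zero_mem, by simp⟩
  | add p q hp hq =>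
    obtain ⟨a, ha, b, hb, c, hc, rfl⟩ := hp
    obtain ⟨a', ha', b', hb', c', hc', rfl⟩ := hq
    exact ⟨a + a', add_mem ha ha', b + b', add_mem hb hb', c + c', add_mem hc hc', by ring⟩
  | mul_X p i hp =>
    obtain ⟨a, ha, b, hb, c, hc, rfl⟩ := hp
    fin_cases i
    · exact ⟨X 0 ^ 2 * b + X 0 * X 1 * c, add_mem (mul_mem hx hb) (mul_mem hxy hc),
        a, ha, 0, S.zero_mem, by simp; ring⟩
    · exact ⟨X 0 * X 1 * b + X 1 ^ 2 * c, add_mem (mul_mem hxy hb) (mul_mem hy hc),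
        0, S.zero_mem, a, ha, by simp; ring⟩
    · exact ⟨a * X 2, mul_mem ha hz, b * X 2, mul_mem hb hz, c * X 2, mul_mem hc hz,
        by simp; ring⟩

/-- Let `φ : ℂ[T₁,…,T₄] → ℂ[x,y,z]` be the `ℂ`-algebra homomorphism with
`φ(T₁) = xy`, `φ(T₂) = x² − y²`, `φ(T₃) = z`, `φ(T₄) = x² + y²`. Then
`ker φ = ⟨4T₁² + T₂² − T₄²⟩` and the image of `φ` is the ring of invariants of the
automorphism `x ↦ −x, y ↦ −y, z ↦ z`. -/
theorem ker_and_range_coxring_D8 :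
    RingHom.ker
      (MvPolynomial.aeval
        ![X 0 * X 1, X 0 ^ 2 - X 1 ^ 2, X 2, X 0 ^ 2 + X 1 ^ 2] :
        MvPolynomial (Fin 4) ℂ →ₐ[ℂ] MvPolynomial (Fin 3) ℂ) =
      Ideal.span {4 * X 0 ^ 2 + X 1 ^ 2 - X 3 ^ 2} ∧
    ((MvPolynomial.aeval
        ![X 0 * X 1, X 0 ^ 2 - X 1 ^ 2, X 2, X 0 ^ 2 + X 1 ^ 2] :
        MvPolynomial (Fin 4) ℂ →ₐ[ℂ] MvPolynomial (Fin 3) ℂ).range : Set (MvPolynomial (Fin 3) ℂ)) =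
      {p : MvPolynomial (Fin 3) ℂ |
        MvPolynomial.aeval ![-X 0, -X 1, X 2] p = p} := by
  set φ : MvPolynomial (Fin 4) ℂ →ₐ[ℂ] MvPolynomial (Fin 3) ℂ :=
    aeval ![X 0 * X 1, X 0 ^ 2 - X 1 ^ 2, X 2, X 0 ^ 2 + X 1 ^ 2] with hφ
  have hφ0 : φ (X 0) = X 0 * X 1 := by simp [hφ]
  have hφ1 : φ (X 1) = X 0 ^ 2 - X 1 ^ 2 := by simp [hφ]
  have hφ2 : φ (X 2) = X 2 := by simp [hφ]
  have hφ3 : φ (X 3) = X 0 ^ 2 + X 1 ^ 2 := by simp [hφ]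
  have hle : Ideal.span {4 * X 0 ^ 2 + X 1 ^ 2 - X 3 ^ 2} ≤ RingHom.ker φ := by
    rw [Ideal.span_singleton_le_iff_mem, RingHom.mem_ker]
    simp only [map_sub, map_add, map_mul, map_pow, map_ofNat, hφ0, hφ1, hφ3]
    ring
  constructor
  · refine le_antisymm (fun p hp => ?_) hle
    obtain ⟨a, b, hab⟩ := exists_sub_rename_add_mem_span p
    set ψ : MvPolynomial (Fin 3) ℂ →ₐ[ℂ] MvPolynomial (Fin 3) ℂ :=
      aeval ![X 0 ^ 2 - X 1 ^ 2, X 2, X 0 ^ 2 + X 1 ^ 2] with hψ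
    have hφψ (q : MvPolynomial (Fin 3) ℂ) : φ (rename Fin.succ q) = ψ q := aeval_rename ..
    have h := hle hab
    rw [RingHom.mem_ker] at hp h
    simp only [map_sub, map_add, map_mul, hp, hφψ, hφ0, zero_sub, neg_eq_zero] at h
    let τ : MvPolynomial (Fin 3) ℂ →ₐ[ℂ] MvPolynomial (Fin 3) ℂ := aeval ![-X 0, X 1, X 2]
    have hτψ (q : MvPolynomial (Fin 3) ℂ) : τ (ψ q) = ψ q := by
      rw [← AlgHom.comp_apply]
      congr 1
      ext1 i
      fin_cases i <;> simp [τ, hψ]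
    have h' := congrArg τ h
    simp only [map_add, map_mul, hτψ, map_zero] at h'
    rw [show τ (X 0) = -X 0 by simp [τ], show τ (X 1) = X 1 by simp [τ]] at h'
    have ha : ψ a = 0 := by
      refine (mul_eq_zero.mp (?_ : 2 * ψ a = 0)).resolve_left two_ne_zero
      linear_combination h + h'
    have hb : ψ b = 0 := by
      rw [ha, zero_add] at h
      exact (mul_eq_zero.mp h).resolve_left (mul_ne_zero (X_ne_zero 0) (X_ne_zero 1))
    have hinj := algebraicIndependent_iff.mp algebraicIndependent_sq_sub_sq_sq_add_sq
    simpa [hinj a ha, hinj b hb] using hab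
  · set σ : MvPolynomial (Fin 3) ℂ →ₐ[ℂ] MvPolynomial (Fin 3) ℂ :=
      aeval ![-X 0, -X 1, X 2] with hσ
    have hσφ (q : MvPolynomial (Fin 4) ℂ) : σ (φ q) = φ q := by
      rw [← AlgHom.comp_apply]
      congr 1
      ext1 i
      fin_cases i <;> simp [hσ, hφ]
    refine Set.Subset.antisymm ?_ fun p hp => ?_
    · rintro _ ⟨q, rfl⟩
      exact hσφ q
    · have hC : (C (1 / 2) : MvPolynomial (Fin 3) ℂ) * 2 = 1 := by
        rw [← map_ofNat (C : ℂ →+* MvPolynomial (Fin 3) ℂ) 2, ← C_mul]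
        norm_num
      have hφC (r : ℂ) : φ (C r) = C r := φ.commutes r
      obtain ⟨_, ⟨a, rfl⟩, _, ⟨b, rfl⟩, _, ⟨c, rfl⟩, rfl⟩ :=
        exists_eq_add_X_mul_add_X_mul φ.range ⟨X 0, hφ0⟩
          ⟨C (1 / 2) * (X 3 + X 1), by
            change φ _ = _
            rw [map_mul, map_add, hφC, hφ1, hφ3]
            linear_combination X 0 ^ 2 * hC⟩
          ⟨C (1 / 2) * (X 3 - X 1), by
            change φ _ = _
            rw [map_mul, map_sub, hφC, hφ1, hφ3]
            linear_combination X 1 ^ 2 * hC⟩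
          ⟨X 2, hφ2⟩ p
      refine ⟨a, ?_⟩
      change φ a = φ a + X 0 * φ b + X 1 * φ c
      change σ (φ a + X 0 * φ b + X 1 * φ c) = φ a + X 0 * φ b + X 1 * φ c at hp
      simp only [map_add, map_mul, hσφ] at hp
      rw [show σ (X 0) = -X 0 by simp [hσ], show σ (X 1) = -X 1 by simp [hσ]] at hp
      refine mul_left_cancel₀ (two_ne_zero (α := MvPolynomial (Fin 3) ℂ)) ?_
      linear_combination hp
end

section
/- Let σ be the ℂ-algebra automorphism of ℂ[x, y, z] induced by the order-3 matrix M = [[0, −1, 0], [1, −1, 0], [0, 0, 1]], i.e. determined by σ(x) = −y, σ(y) = x − y, σ(z) = z. Then the subalgebra of σ-invariant polynomials {p ∈ ℂ[x, y, z] ∣ σ(p) = p} is isomorphic as a ℂ-algebra to the quotient ring ℂ[T₁, T₂, T₃, T₄]/⟨4T₃³ − T₂² − 27T₄²⟩. -/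
open MvPolynomial

/-- Two linear maps on polynomials in three variables agree if they agree on all monomials. -/
lemma linearMap_ext_of_monomials {K V : Type*} [CommRing K] [AddCommGroup V] [Module K V]
    {f g : MvPolynomial (Fin 3) K →ₗ[K] V}
    (h : ∀ i j k : ℕ, f (X 0 ^ i * X 1 ^ j * X 2 ^ k) = g (X 0 ^ i * X 1 ^ j * X 2 ^ k)) :
    f = g := by
  refine (basisMonomials (Fin 3) K).ext fun m => ?_
  have hm : basisMonomials (Fin 3) K m = X 0 ^ m 0 * X 1 ^ m 1 * X 2 ^ m 2 := by
    simp [monomial_eq, Finsupp.prod_fintype, Fin.prod_univ_three]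
  rw [hm]
  exact h _ _ _

section CyclicQuotient

variable {K Q : Type*} [Field K] [CommRing Q] [Algebra K Q]

/-- The linear map sending the monomial `u ^ i * v ^ j * w ^ k` to
`a ^ (i / 3) * b ^ (j / 3) * c ^ (i % 3) * d ^ k` if `i ≡ j mod 3`, and to `0` otherwise. -/
noncomputable def cyclicProjection (K : Type*) {Q : Type*} [Field K] [CommRing Q] [Algebra K Q]
    (a b c d : Q) : MvPolynomial (Fin 3) K →ₗ[K] Q :=
  (basisMonomials (Fin 3) K).constr K fun m =>
    if m 0 % 3 = m 1 % 3 then a ^ (m 0 / 3) * b ^ (m 1 / 3) * c ^ (m 0 % 3) * d ^ m 2 else 0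

lemma cyclicProjection_apply (a b c d : Q) (i j k : ℕ) :
    cyclicProjection K a b c d (X 0 ^ i * X 1 ^ j * X 2 ^ k) =
      if i % 3 = j % 3 then a ^ (i / 3) * b ^ (j / 3) * c ^ (i % 3) * d ^ k else 0 := by
  let m : Fin 3 →₀ ℕ := Finsupp.equivFunOnFinite.symm ![i, j, k]
  have hm : X 0 ^ i * X 1 ^ j * X 2 ^ k = basisMonomials (Fin 3) K m := by
    simp [m, monomial_eq, Finsupp.prod_fintype, Fin.prod_univ_three]
  rw [hm, cyclicProjection, Module.Basis.constr_basis]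
  simp [m]

lemma cyclicProjection_mul (a b c d : Q) (habc : a * b = c ^ 3) {q : Q}
    (hq : q ∈ Algebra.adjoin K {a, b, c, d}) (f : Q →ₐ[K] MvPolynomial (Fin 3) K)
    (ha : f a = X 0 ^ 3) (hb : f b = X 1 ^ 3) (hc : f c = X 0 * X 1) (hd : f d = X 2)
    (r : MvPolynomial (Fin 3) K) :
    cyclicProjection K a b c d (f q * r) = q * cyclicProjection K a b c d r := by
  have key (p : MvPolynomial (Fin 3) K) (s : Q)
      (h : ∀ i j k : ℕ, cyclicProjection K a b c d (p * (X 0 ^ i * X 1 ^ j * X 2 ^ k)) =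
        s * cyclicProjection K a b c d (X 0 ^ i * X 1 ^ j * X 2 ^ k))
      (r : MvPolynomial (Fin 3) K) :
      cyclicProjection K a b c d (p * r) = s * cyclicProjection K a b c d r := by
    have h_ext : cyclicProjection K a b c d ∘ₗ LinearMap.mulLeft K p =
        LinearMap.mulLeft K s ∘ₗ cyclicProjection K a b c d :=
      linearMap_ext_of_monomials (by simpa using h)
    exact LinearMap.congr_fun h_ext r
  induction hq using Algebra.adjoin_induction generalizing r with
  | mem x hx =>
    rcases hx with rfl | rfl | rfl | rfl
    · rw [ha]
      refine key _ _ (fun i j k => ?_) r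
      rw [show (X 0 ^ 3 * (X 0 ^ i * X 1 ^ j * X 2 ^ k) : MvPolynomial (Fin 3) K) =
        X 0 ^ (i + 3) * X 1 ^ j * X 2 ^ k by ring, cyclicProjection_apply, cyclicProjection_apply,
        Nat.add_mod_right, Nat.add_div_right _ three_pos]
      split_ifs <;> ring
    · rw [hb]
      refine key _ _ (fun i j k => ?_) r
      rw [show (X 1 ^ 3 * (X 0 ^ i * X 1 ^ j * X 2 ^ k) : MvPolynomial (Fin 3) K) =
        X 0 ^ i * X 1 ^ (j + 3) * X 2 ^ k by ring, cyclicProjection_apply, cyclicProjection_apply,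
        Nat.add_mod_right, Nat.add_div_right _ three_pos]
      split_ifs <;> ring
    · rw [hc]
      refine key _ _ (fun i j k => ?_) r
      rw [show (X 0 * X 1 * (X 0 ^ i * X 1 ^ j * X 2 ^ k) : MvPolynomial (Fin 3) K) =
        X 0 ^ (i + 1) * X 1 ^ (j + 1) * X 2 ^ k by ring, cyclicProjection_apply,
        cyclicProjection_apply]
      by_cases h : i % 3 = j % 3
      · rw [if_pos h, if_pos (by omega)]
        by_cases h2 : i % 3 = 2
        · rw [show (i + 1) / 3 = i / 3 + 1 by omega, show (j + 1) / 3 = j / 3 + 1 by omega,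
            show (i + 1) % 3 = 0 by omega, h2]
          linear_combination a ^ (i / 3) * b ^ (j / 3) * d ^ k * habc
        · rw [show (i + 1) / 3 = i / 3 by omega, show (j + 1) / 3 = j / 3 by omega,
            show (i + 1) % 3 = i % 3 + 1 by omega]
          ring
      · rw [if_neg h, if_neg (by omega), mul_zero]
    · rw [hd]
      refine key _ _ (fun i j k => ?_) r
      rw [show (X 2 * (X 0 ^ i * X 1 ^ j * X 2 ^ k) : MvPolynomial (Fin 3) K) =
        X 0 ^ i * X 1 ^ j * X 2 ^ (k + 1) by ring, cyclicProjection_apply, cyclicProjection_apply]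
      split_ifs <;> ring
  | algebraMap t =>
    rw [AlgHom.commutes, ← Algebra.smul_def, ← Algebra.smul_def, map_smul]
  | add x y _ _ hx hy => rw [map_add, add_mul, map_add, hx, hy, add_mul]
  | mul x y _ _ hx hy => rw [map_mul f, mul_assoc, hx, hy, mul_assoc]

lemma cyclicProjection_leftInverse (a b c d : Q) (habc : a * b = c ^ 3)
    (htop : Algebra.adjoin K {a, b, c, d} = ⊤) (f : Q →ₐ[K] MvPolynomial (Fin 3) K)
    (ha : f a = X 0 ^ 3) (hb : f b = X 1 ^ 3) (hc : f c = X 0 * X 1) (hd : f d = X 2) :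
    Function.LeftInverse (cyclicProjection K a b c d) f := by
  intro q
  have h_one : cyclicProjection K a b c d 1 = 1 := by
    simpa using cyclicProjection_apply (K := K) a b c d 0 0 0
  simpa [h_one] using
    cyclicProjection_mul a b c d habc (q := q) (by simp [htop]) f ha hb hc hd 1

/-- Composing with the projection gives three times the Reynolds operator of the diagonal
action of a cube root of unity. -/
lemma three_mul_cyclicProjection (a b c d : Q) (f : Q →ₐ[K] MvPolynomial (Fin 3) K)
    (ha : f a = X 0 ^ 3) (hb : f b = X 1 ^ 3) (hc : f c = X 0 * X 1) (hd : f d = X 2)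
    {ω : K} (hω : ω ^ 2 + ω + 1 = 0) (s : MvPolynomial (Fin 3) K →ₐ[K] MvPolynomial (Fin 3) K)
    (hs0 : s (X 0) = C ω * X 0) (hs1 : s (X 1) = C (ω ^ 2) * X 1) (hs2 : s (X 2) = X 2)
    (r : MvPolynomial (Fin 3) K) :
    3 * f (cyclicProjection K a b c d r) = r + s r + s (s r) := by
  have h_ext : (3 : K) • (f.toLinearMap ∘ₗ cyclicProjection K a b c d) =
      LinearMap.id + s.toLinearMap + s.toLinearMap ∘ₗ s.toLinearMap := by
    refine linearMap_ext_of_monomials fun i j k => ?_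
    have hω3 : ω ^ 3 = 1 := by linear_combination (ω - 1) * hω
    have hsC (t : K) : s (C t) = C t := s.commutes t
    have hs (i j k : ℕ) : s (X 0 ^ i * X 1 ^ j * X 2 ^ k) =
        C (ω ^ (i + 2 * j)) * (X 0 ^ i * X 1 ^ j * X 2 ^ k) := by
      simp only [map_mul, map_pow, hs0, hs1, hs2, mul_pow]
      ring
    have hmod : ω ^ (i + 2 * j) = ω ^ ((i + 2 * j) % 3) := by
      conv_lhs => rw [← Nat.div_add_mod (i + 2 * j) 3, pow_add, pow_mul, hω3, one_pow, one_mul]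
    have hC : (C ω : MvPolynomial (Fin 3) K) ^ 2 + C ω + 1 = 0 := by
      simpa using congrArg (C : K → MvPolynomial (Fin 3) K) hω
    simp only [LinearMap.smul_apply, LinearMap.comp_apply, LinearMap.add_apply, LinearMap.id_apply,
      AlgHom.toLinearMap_apply, hs, map_mul s (C _), hsC, hmod, cyclicProjection_apply, smul_eq_C_mul]
    by_cases h : i % 3 = j % 3
    · rw [if_pos h, show (i + 2 * j) % 3 = 0 by omega]
      have h_mon : f (a ^ (i / 3) * b ^ (j / 3) * c ^ (i % 3) * d ^ k) =
          X 0 ^ i * X 1 ^ j * X 2 ^ k := by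
        simp only [map_mul, map_pow, ha, hb, hc, hd]
        conv_rhs => rw [← Nat.div_add_mod i 3, ← Nat.div_add_mod j 3, ← h]
        ring
      rw [h_mon, show (C (3 : K) : MvPolynomial (Fin 3) K) = 3 from map_ofNat C 3]
      simp only [pow_zero, C_1]
      ring
    · rw [if_neg h, map_zero, mul_zero]
      have h12 : (i + 2 * j) % 3 = 1 ∨ (i + 2 * j) % 3 = 2 := by omega
      rcases h12 with h1 | h2
      · rw [h1, pow_one]
        linear_combination -(X 0 ^ i * X 1 ^ j * X 2 ^ k) * hC
      · rw [h2, C_pow]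
        linear_combination -(X 0 ^ i * X 1 ^ j * X 2 ^ k) * (C ω ^ 2 - C ω + 1) * hC
  have := LinearMap.congr_fun h_ext r
  simpa [smul_eq_C_mul, show (C (3 : K) : MvPolynomial (Fin 3) K) = 3 from map_ofNat C 3] using this

end CyclicQuotient

/-- The linear change of coordinates to the eigenvectors `x + ω y`, `x + ω² y`, `z`. -/
lemma exists_eigencoordinates {ω : ℂ} (hω : ω ^ 2 + ω + 1 = 0) :
    ∃ τ : MvPolynomial (Fin 3) ℂ ≃ₐ[ℂ] MvPolynomial (Fin 3) ℂ,
      τ (X 0) = X 0 + C ω * X 1 ∧ τ (X 1) = X 0 + C (ω ^ 2) * X 1 ∧ τ (X 2) = X 2 := by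
  have hC : (C ω : MvPolynomial (Fin 3) ℂ) ^ 2 + C ω + 1 = 0 := by
    simpa using congrArg (C : ℂ → MvPolynomial (Fin 3) ℂ) hω
  have h3 : (C (1 / 3) : MvPolynomial (Fin 3) ℂ) * 3 = 1 := by
    rw [← map_ofNat (C : ℂ →+* MvPolynomial (Fin 3) ℂ) 3, ← C_mul]
    norm_num
  let F : MvPolynomial (Fin 3) ℂ →ₐ[ℂ] MvPolynomial (Fin 3) ℂ :=
    aeval ![X 0 + C ω * X 1, X 0 + C (ω ^ 2) * X 1, X 2]
  let G : MvPolynomial (Fin 3) ℂ →ₐ[ℂ] MvPolynomial (Fin 3) ℂ :=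
    aeval ![X 0 - C ω * (C (1 / 3) * (C (ω ^ 2) - C ω) * (X 0 - X 1)),
      C (1 / 3) * (C (ω ^ 2) - C ω) * (X 0 - X 1), X 2]
  have hFC (t : ℂ) : F (C t) = C t := F.commutes t
  have hGC (t : ℂ) : G (C t) = C t := G.commutes t
  have hF0 : F (X 0) = X 0 + C ω * X 1 := by simp [F]
  have hF1 : F (X 1) = X 0 + C (ω ^ 2) * X 1 := by simp [F]
  have hF2 : F (X 2) = X 2 := by simp [F]
  have hG0 : G (X 0) = X 0 - C ω * (C (1 / 3) * (C (ω ^ 2) - C ω) * (X 0 - X 1)) := by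
    simp only [G, aeval_X, Matrix.cons_val]
  have hG1 : G (X 1) = C (1 / 3) * (C (ω ^ 2) - C ω) * (X 0 - X 1) := by
    simp only [G, aeval_X, Matrix.cons_val]
  have hG2 : G (X 2) = X 2 := by simp [G]
  have hdisc : (C (1 / 3) : MvPolynomial (Fin 3) ℂ) * (C ω ^ 2 - C ω) * (C ω - C ω ^ 2) = 1 := by
    linear_combination -C (1 / 3) * (C ω ^ 2 - 3 * C ω + 3) * hC + h3
  refine ⟨AlgEquiv.ofAlgHom F G ?_ ?_, hF0, hF1, hF2⟩
  · ext1 i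
    fin_cases i <;>
      simp only [Fin.zero_eta, Fin.mk_one, Fin.reduceFinMk, AlgHom.comp_apply, AlgHom.id_apply,
        hG0, hG1, hG2, map_sub, map_mul, map_pow, hFC, hF0, hF1, hF2]
    · linear_combination -C ω * X 1 * hdisc
    · linear_combination X 1 * hdisc
  · ext1 i
    fin_cases i <;>
      simp only [Fin.zero_eta, Fin.mk_one, Fin.reduceFinMk, AlgHom.comp_apply, AlgHom.id_apply,
        hG0, hG1, hG2, map_add, map_mul, map_pow, hGC, hF0, hF1, hF2]
    · ring
    · linear_combination (X 1 - X 0) * hdisc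

/-- Let `σ` be the `ℂ`-algebra automorphism of `ℂ[x, y, z]` induced by the order-3
matrix `[[0,−1,0],[1,−1,0],[0,0,1]]`, i.e. `σ(x) = −y`, `σ(y) = x − y`, `σ(z) = z`.
Then the subalgebra of `σ`-invariant polynomials is isomorphic as a `ℂ`-algebra to
`ℂ[T₁,…,T₄]/⟨4T₃³ − T₂² − 27T₄²⟩`. -/
theorem invariants_iso_coxring_S3
    (σ : MvPolynomial (Fin 3) ℂ ≃ₐ[ℂ] MvPolynomial (Fin 3) ℂ)
    (hx : σ (X 0) = -X 1) (hy : σ (X 1) = X 0 - X 1) (hz : σ (X 2) = X 2) :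
    Nonempty
      ((AlgHom.equalizer σ.toAlgHom (AlgHom.id ℂ (MvPolynomial (Fin 3) ℂ))) ≃ₐ[ℂ]
        (MvPolynomial (Fin 4) ℂ ⧸
          Ideal.span ({4 * X 2 ^ 3 - X 1 ^ 2 - 27 * X 3 ^ 2} :
            Set (MvPolynomial (Fin 4) ℂ)))) := by
  obtain ⟨ω, hω⟩ : ∃ ω : ℂ, ω ^ 2 + ω + 1 = 0 := by
    have h := (Complex.isPrimitiveRoot_exp 3 (by norm_num)).geom_sum_eq_zero (by norm_num)
    simp only [Finset.sum_range_succ, Finset.sum_range_zero] at h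
    exact ⟨Complex.exp (2 * Real.pi * Complex.I / (3 : ℕ)), by linear_combination h⟩
  obtain ⟨τ, hτ0, hτ1, hτ2⟩ := exists_eigencoordinates hω
  obtain ⟨e, he⟩ : ∃ e : ℂ, e ^ 2 = -27 := ⟨3 * (ω - ω ^ 2), by
    linear_combination 9 * (ω ^ 2 - 3 * ω + 3) * hω⟩
  have he0 : e ≠ 0 := by rintro rfl; norm_num at he
  set I := Ideal.span ({4 * X 2 ^ 3 - X 1 ^ 2 - 27 * X 3 ^ 2} : Set (MvPolynomial (Fin 4) ℂ))
  let g : MvPolynomial (Fin 4) ℂ →ₐ[ℂ] MvPolynomial (Fin 3) ℂ :=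
    aeval ![X 2, X 0 ^ 3 + X 1 ^ 3, X 0 * X 1, C e⁻¹ * (X 0 ^ 3 - X 1 ^ 3)]
  have hg0 : g (X 0) = X 2 := by simp [g]
  have hg1 : g (X 1) = X 0 ^ 3 + X 1 ^ 3 := by simp [g]
  have hg2 : g (X 2) = X 0 * X 1 := by simp [g]
  have hg3 : g (X 3) = C e⁻¹ * (X 0 ^ 3 - X 1 ^ 3) := by simp [g]
  have hgC (t : ℂ) : g (C t) = C t := g.commutes t
  have hCe : (C e⁻¹ : MvPolynomial (Fin 3) ℂ) ^ 2 * 27 = -1 := by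
    rw [← map_ofNat (C : ℂ →+* MvPolynomial (Fin 3) ℂ) 27, ← C_pow, ← C_mul, inv_pow, he]
    norm_num
  have hCe' : (C e : MvPolynomial (Fin 3) ℂ) * C e⁻¹ = 1 := by
    rw [← C_mul, mul_inv_cancel₀ he0, C_1]
  have hCh : (C (1 / 2) : MvPolynomial (Fin 3) ℂ) * 2 = 1 := by
    rw [← map_ofNat (C : ℂ →+* MvPolynomial (Fin 3) ℂ) 2, ← C_mul]
    norm_num
  have hker : ∀ p ∈ I, g p = 0 := by
    intro p hp
    obtain ⟨q, rfl⟩ := Ideal.mem_span_singleton'.1 hp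
    simp only [map_mul, map_sub, map_pow, map_ofNat, hg1, hg2, hg3]
    linear_combination -g q * (X 0 ^ 3 - X 1 ^ 3) ^ 2 * hCe
  let f : (MvPolynomial (Fin 4) ℂ ⧸ I) →ₐ[ℂ] MvPolynomial (Fin 3) ℂ := Ideal.Quotient.liftₐ I g hker
  let π := Ideal.Quotient.mkₐ ℂ I
  have hf (p) : f (π p) = g p := rfl
  let a := π (C (1 / 2) * (X 1 + C e * X 3))
  let b := π (C (1 / 2) * (X 1 - C e * X 3))
  have ha : f a = X 0 ^ 3 := by
    simp only [a, hf, map_mul, map_add, hgC, hg1, hg3]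
    linear_combination C (1 / 2) * (X 0 ^ 3 - X 1 ^ 3) * hCe' + X 0 ^ 3 * hCh
  have hb : f b = X 1 ^ 3 := by
    simp only [b, hf, map_mul, map_sub, hgC, hg1, hg3]
    linear_combination -C (1 / 2) * (X 0 ^ 3 - X 1 ^ 3) * hCe' + X 1 ^ 3 * hCh
  have habc : a * b = π (X 2) ^ 3 := by
    rw [← map_mul, ← map_pow]
    refine Ideal.Quotient.eq.2 (Ideal.mem_span_singleton'.2 ⟨-C (1 / 4), ?_⟩)
    have h4 : (C (1 / 4) : MvPolynomial (Fin 4) ℂ) * 4 = 1 := by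
      rw [← map_ofNat (C : ℂ →+* MvPolynomial (Fin 4) ℂ) 4, ← C_mul]
      norm_num
    have h2 : (C (1 / 2) : MvPolynomial (Fin 4) ℂ) ^ 2 = C (1 / 4) := by
      rw [← C_pow]
      norm_num
    have h27 : (C e : MvPolynomial (Fin 4) ℂ) ^ 2 = -27 := by
      rw [← C_pow, he, C_neg, map_ofNat]
    linear_combination -X 2 ^ 3 * h4 - (X 1 ^ 2 - C e ^ 2 * X 3 ^ 2) * h2 +
      C (1 / 4) * X 3 ^ 2 * h27
  have htop : Algebra.adjoin ℂ {a, b, π (X 2), π (X 0)} = ⊤ := by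
    set S := Algebra.adjoin ℂ {a, b, π (X 2), π (X 0)}
    have haS : a ∈ S := Algebra.subset_adjoin (by simp)
    have hbS : b ∈ S := Algebra.subset_adjoin (by simp)
    have h2 : (C (1 / 2) : MvPolynomial (Fin 4) ℂ) * 2 = 1 := by
      rw [← map_ofNat (C : ℂ →+* MvPolynomial (Fin 4) ℂ) 2, ← C_mul]
      norm_num
    have h1 : π (X 1) = a + b := by
      rw [← map_add]
      congr 1
      linear_combination -X 1 * h2
    have h3 : π (X 3) = e⁻¹ • (a - b) := by
      rw [← map_sub, ← map_smul]
      congr 1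
      have h' : (C e⁻¹ : MvPolynomial (Fin 4) ℂ) * C e = 1 := by
        rw [← C_mul, inv_mul_cancel₀ he0, C_1]
      rw [smul_eq_C_mul]
      linear_combination -X 3 * h' - C e⁻¹ * C e * X 3 * h2
    have hX (i : Fin 4) : π (X i) ∈ S := by
      fin_cases i
      · exact Algebra.subset_adjoin (by simp)
      · exact h1 ▸ add_mem haS hbS
      · exact Algebra.subset_adjoin (by simp)
      · exact h3 ▸ S.smul_mem (sub_mem haS hbS) _
    refine Algebra.eq_top_iff.2 fun q => ?_
    obtain ⟨p, rfl⟩ := Ideal.Quotient.mkₐ_surjective ℂ I q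
    induction p using MvPolynomial.induction_on with
    | C t => exact S.algebraMap_mem t
    | add p q hp hq => exact map_add π p q ▸ add_mem hp hq
    | mul_X p i hp => exact map_mul π p (X i) ▸ mul_mem hp (hX i)
  have hinj : Function.Injective f :=
    (cyclicProjection_leftInverse a b _ _ habc htop f ha hb hg2 hg0).injective
  let s : MvPolynomial (Fin 3) ℂ →ₐ[ℂ] MvPolynomial (Fin 3) ℂ :=
    aeval ![C ω * X 0, C (ω ^ 2) * X 1, X 2]
  have hs0 : s (X 0) = C ω * X 0 := by simp [s]
  have hs1 : s (X 1) = C (ω ^ 2) * X 1 := by simp [s]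
  have hs2 : s (X 2) = X 2 := by simp [s]
  have hcomm : σ.toAlgHom.comp τ.toAlgHom = τ.toAlgHom.comp s := by
    have hC : (C ω : MvPolynomial (Fin 3) ℂ) ^ 2 + C ω + 1 = 0 := by
      simpa using congrArg (C : ℂ → MvPolynomial (Fin 3) ℂ) hω
    have hσC (t : ℂ) : σ (C t) = C t := σ.commutes t
    have hτC (t : ℂ) : τ (C t) = C t := τ.commutes t
    ext1 i
    fin_cases i <;>
      simp only [Fin.zero_eta, Fin.mk_one, Fin.reduceFinMk, AlgHom.comp_apply,
        AlgEquiv.toAlgHom_apply, hτ0, hτ1, hτ2, hs0, hs1, hs2, map_add, map_mul, map_pow, hσC, hτC,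
        hx, hy, hz]
    · linear_combination -X 1 * hC
    · linear_combination -X 1 * (C ω ^ 2 - C ω + 1) * hC
  have hστ (r) : σ (τ r) = τ (s r) := AlgHom.congr_fun hcomm r
  let h : (MvPolynomial (Fin 4) ℂ ⧸ I) →ₐ[ℂ] MvPolynomial (Fin 3) ℂ := τ.toAlgHom.comp f
  have hrange : h.range = AlgHom.equalizer σ.toAlgHom (AlgHom.id ℂ (MvPolynomial (Fin 3) ℂ)) := by
    ext p
    obtain ⟨r, rfl⟩ := τ.surjective p
    have hmem : τ r ∈ AlgHom.equalizer σ.toAlgHom (AlgHom.id ℂ (MvPolynomial (Fin 3) ℂ)) ↔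
        s r = r := by
      rw [AlgHom.mem_equalizer]
      change σ (τ r) = τ r ↔ s r = r
      rw [hστ, τ.injective.eq_iff]
    rw [hmem]
    constructor
    · rintro ⟨q, h_eq⟩
      obtain rfl : f q = r := τ.injective h_eq
      have hq : q ∈ Algebra.adjoin ℂ {a, b, π (X 2), π (X 0)} := by simp [htop]
      have hω3 : ω ^ 3 = 1 := by linear_combination (ω - 1) * hω
      have hCω3 : (C ω : MvPolynomial (Fin 3) ℂ) ^ 3 = 1 := by rw [← C_pow, hω3, C_1]
      clear hmem h_eq
      induction hq using Algebra.adjoin_induction with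
      | mem x hx =>
        rcases hx with rfl | rfl | rfl | rfl
        · rw [ha, map_pow, hs0, mul_pow, hCω3, one_mul]
        · rw [hb, map_pow, hs1, mul_pow, C_pow, ← pow_mul, mul_comm 2 3, pow_mul, hCω3, one_pow,
            one_mul]
        · rw [hf, hg2, map_mul, hs0, hs1, C_pow]
          linear_combination X 0 * X 1 * hCω3
        · rw [hf, hg0, hs2]
      | algebraMap t => rw [f.commutes, s.commutes]
      | add x y _ _ hx hy => rw [map_add, map_add, hx, hy]
      | mul x y _ _ hx hy => rw [map_mul, map_mul, hx, hy]
    · intro hr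
      refine ⟨cyclicProjection ℂ a b (π (X 2)) (π (X 0)) r, congrArg τ ?_⟩
      have key := three_mul_cyclicProjection a b (π (X 2)) (π (X 0)) f ha hb hg2 hg0 hω s hs0 hs1
        hs2 r
      rw [hr, hr] at key
      have h3 : (3 : MvPolynomial (Fin 3) ℂ) ≠ 0 := by norm_num
      exact mul_left_cancel₀ h3 (key.trans (by ring))
  exact ⟨((AlgEquiv.ofInjective h (τ.injective.comp hinj)).trans
    (Subalgebra.equivOfEq _ _ hrange)).symm⟩
end

section
/- Let ε be a primitive third root of unity in ℂ and let V ⊂ GL(3, ℂ) be the Klein four-group consisting of the diagonal matrices diag(1,1,1), diag(−1,−1,1), diag(−1,1,−1), diag(1,−1,−1), acting on ℂ[x, y, z] by the induced ℂ-algebra automorphisms (sign changes of the variables). Then the subalgebra of V-invariant polynomials equals the ℂ-subalgebra generated by the four elements x² + y² + z², xyz, x² + εy² + ε²z², and x² + ε²y² + εz². -/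
open MvPolynomial

namespace MvPolynomial

/-- Rescaling the variables by `s` multiplies the coefficient of each monomial `d` by `s ^ d`. -/
theorem coeff_aeval_C_mul_X_s13 {σ R : Type*} [CommSemiring R] (s : σ → R)
    (p : MvPolynomial σ R) (d : σ →₀ ℕ) :
    coeff d (aeval (fun i => C (s i) * X i) p : MvPolynomial σ R) =
      (d.prod fun i n => s i ^ n) * coeff d p := by
  classical
  induction p using MvPolynomial.induction_on' with
  | monomial e c =>
    have h : (aeval (fun i => C (s i) * X i) (monomial e c) : MvPolynomial σ R) =
        C (e.prod fun i n => s i ^ n) * monomial e c := by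
      rw [aeval_monomial, monomial_eq, algebraMap_eq, Finsupp.prod, Finsupp.prod, Finsupp.prod]
      simp only [mul_pow, Finset.prod_mul_distrib, map_prod, map_pow]
      ring
    rw [h, coeff_C_mul, coeff_monomial]
    split_ifs with hed
    · rw [hed]
    · simp
  | add p q hp hq => simp only [map_add, coeff_add, hp, hq, mul_add]

/-- A polynomial fixed by rescaling the variables by `s` is supported on exponents `d` with
`s ^ d = 1`. -/
theorem prod_pow_eq_one_of_aeval_C_mul_X_eq_self {σ R : Type*} [CommRing R] [IsDomain R]
    {s : σ → R} {p : MvPolynomial σ R}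
    (hp : aeval (fun i => C (s i) * X i) p = p) {d : σ →₀ ℕ} (hd : d ∈ p.support) :
    (d.prod fun i n => s i ^ n) = 1 := by
  have h := coeff_aeval_C_mul_X_s13 s p d
  rw [hp] at h
  exact (mul_eq_right₀ (mem_support_iff.mp hd)).mp h.symm

/-- A subalgebra containing `xyz` and the squares of the variables contains every monomial whose
three exponents have the same parity. -/
theorem monomial_mem_of_parity {R : Type*} [CommSemiring R]
    {A : Subalgebra R (MvPolynomial (Fin 3) R)} (hxyz : X 0 * X 1 * X 2 ∈ A)
    (hsq : ∀ i, X i ^ 2 ∈ A) {d : Fin 3 →₀ ℕ} (h01 : Even (d 0 + d 1)) (h02 : Even (d 0 + d 2))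
    (c : R) : monomial d c ∈ A := by
  have hd : ∀ i, d i = d 0 % 2 + 2 * (d i / 2) := by
    intro i
    rw [Nat.even_iff] at h01 h02
    fin_cases i <;> simp <;> omega
  have h : monomial d c = C c * ((X 0 * X 1 * X 2) ^ (d 0 % 2) *
      ((X 0 ^ 2) ^ (d 0 / 2) * (X 1 ^ 2) ^ (d 1 / 2) * (X 2 ^ 2) ^ (d 2 / 2))) := by
    rw [monomial_eq, Finsupp.prod_fintype _ _ (by simp), Fin.prod_univ_three]
    conv_lhs => rw [hd 0, hd 1, hd 2]
    simp only [pow_add, pow_mul, mul_pow]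
    ring
  rw [h]
  exact A.mul_mem (A.algebraMap_mem c) (A.mul_mem (A.pow_mem hxyz _)
    (A.mul_mem (A.mul_mem (A.pow_mem (hsq 0) _) (A.pow_mem (hsq 1) _)) (A.pow_mem (hsq 2) _)))

/-- The discrete Fourier transform of order three recovers the squares of the variables. -/
theorem X_sq_mem_of_fourier {K : Type*} [Field K] (h3 : (3 : K) ≠ 0) {ε : K}
    (hε : 1 + ε + ε ^ 2 = 0) {A : Subalgebra K (MvPolynomial (Fin 3) K)}
    (h1 : X 0 ^ 2 + X 1 ^ 2 + X 2 ^ 2 ∈ A)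
    (h2 : X 0 ^ 2 + C ε * X 1 ^ 2 + C (ε ^ 2) * X 2 ^ 2 ∈ A)
    (h3' : X 0 ^ 2 + C (ε ^ 2) * X 1 ^ 2 + C ε * X 2 ^ 2 ∈ A) (i : Fin 3) :
    X i ^ 2 ∈ A := by
  have hC : (1 + C ε + C ε ^ 2 : MvPolynomial (Fin 3) K) = 0 := by
    simpa using congrArg (C (σ := Fin 3)) hε
  have key : ∀ a b : K, C 3⁻¹ * ((X 0 ^ 2 + X 1 ^ 2 + X 2 ^ 2) +
      C a * (X 0 ^ 2 + C ε * X 1 ^ 2 + C (ε ^ 2) * X 2 ^ 2) +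
      C b * (X 0 ^ 2 + C (ε ^ 2) * X 1 ^ 2 + C ε * X 2 ^ 2)) ∈ A := fun a b =>
    A.mul_mem (A.algebraMap_mem _) (A.add_mem (A.add_mem h1 (A.mul_mem (A.algebraMap_mem a) h2))
      (A.mul_mem (A.algebraMap_mem b) h3'))
  have hthird : (C 3⁻¹ * 3 : MvPolynomial (Fin 3) K) = 1 := by
    rw [← map_ofNat (C (σ := Fin 3)) 3, ← C_mul, inv_mul_cancel₀ h3, C_1]
  fin_cases i
  · change X 0 ^ 2 ∈ A
    convert key 1 1 using 1
    simp only [map_pow, map_one]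
    linear_combination (-X 0 ^ 2) * hthird - C 3⁻¹ * (X 1 ^ 2 + X 2 ^ 2) * hC
  · change X 1 ^ 2 ∈ A
    convert key (ε ^ 2) ε using 1
    simp only [map_pow]
    linear_combination (-X 1 ^ 2) * hthird - C 3⁻¹ * (X 0 ^ 2 + 2 * (C ε - 1) * X 1 ^ 2
      + (C ε ^ 2 - C ε + 1) * X 2 ^ 2) * hC
  · change X 2 ^ 2 ∈ A
    convert key ε (ε ^ 2) using 1
    simp only [map_pow]
    linear_combination (-X 2 ^ 2) * hthird - C 3⁻¹ * (X 0 ^ 2 + 2 * (C ε - 1) * X 2 ^ 2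
      + (C ε ^ 2 - C ε + 1) * X 1 ^ 2) * hC

end MvPolynomial

/-- Let `ε` be a primitive third root of unity. The polynomials in `ℂ[x, y, z]`
invariant under the Klein four-group of sign changes
`diag(1,1,1), diag(−1,−1,1), diag(−1,1,−1), diag(1,−1,−1)` form exactly the
`ℂ`-subalgebra generated by `x² + y² + z²`, `xyz`, `x² + εy² + ε²z²` and
`x² + ε²y² + εz²`. -/
theorem klein_invariants_eq_adjoin_A4
    (ε : ℂ) (hε3 : ε ^ 3 = 1) (hε1 : ε ≠ 1) :
    {p : MvPolynomial (Fin 3) ℂ |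
        MvPolynomial.aeval ![-X 0, -X 1, X 2] p = p ∧
        MvPolynomial.aeval ![-X 0, X 1, -X 2] p = p ∧
        MvPolynomial.aeval ![X 0, -X 1, -X 2] p = p} =
      ↑(Algebra.adjoin ℂ
        ({X 0 ^ 2 + X 1 ^ 2 + X 2 ^ 2,
          X 0 * X 1 * X 2,
          X 0 ^ 2 + C ε * X 1 ^ 2 + C (ε ^ 2) * X 2 ^ 2,
          X 0 ^ 2 + C (ε ^ 2) * X 1 ^ 2 + C ε * X 2 ^ 2} :
          Set (MvPolynomial (Fin 3) ℂ))) := by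
  set S : Set (MvPolynomial (Fin 3) ℂ) := {X 0 ^ 2 + X 1 ^ 2 + X 2 ^ 2,
    X 0 * X 1 * X 2,
    X 0 ^ 2 + C ε * X 1 ^ 2 + C (ε ^ 2) * X 2 ^ 2,
    X 0 ^ 2 + C (ε ^ 2) * X 1 ^ 2 + C ε * X 2 ^ 2} with hS
  have hε : 1 + ε + ε ^ 2 = 0 :=
    mul_left_cancel₀ (sub_ne_zero.mpr hε1) (by linear_combination hε3)
  have fixed : ∀ f : MvPolynomial (Fin 3) ℂ →ₐ[ℂ] MvPolynomial (Fin 3) ℂ,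
      (∀ q ∈ S, f q = q) → ∀ p ∈ Algebra.adjoin ℂ S, f p = p := fun f hf p hp =>
    (Algebra.adjoin_le hf : Algebra.adjoin ℂ S ≤ AlgHom.equalizer f (AlgHom.id ℂ _)) hp
  ext p
  simp only [Set.mem_ofPred_eq, SetLike.mem_coe]
  constructor
  · rintro ⟨h01, h02, -⟩
    have v01 : (![-X 0, -X 1, X 2] : Fin 3 → MvPolynomial (Fin 3) ℂ) =
        fun i => C (![-1, -1, 1] i) * X i := by
      funext i; fin_cases i <;> simp
    have v02 : (![-X 0, X 1, -X 2] : Fin 3 → MvPolynomial (Fin 3) ℂ) =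
        fun i => C (![-1, 1, -1] i) * X i := by
      funext i; fin_cases i <;> simp
    rw [v01] at h01
    rw [v02] at h02
    rw [p.as_sum]
    refine Subalgebra.sum_mem _ fun d hd => ?_
    have e01 := prod_pow_eq_one_of_aeval_C_mul_X_eq_self h01 hd
    have e02 := prod_pow_eq_one_of_aeval_C_mul_X_eq_self h02 hd
    rw [Finsupp.prod_fintype _ _ (by simp), Fin.prod_univ_three] at e01 e02
    refine monomial_mem_of_parity (Algebra.subset_adjoin (by simp [hS]))
      (X_sq_mem_of_fourier three_ne_zero hε (Algebra.subset_adjoin (by simp [hS]))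
        (Algebra.subset_adjoin (by simp [hS])) (Algebra.subset_adjoin (by simp [hS]))) ?_ ?_ _
    · exact (neg_one_pow_eq_one_iff_even (R := ℂ) (by norm_num)).mp
        (by simpa [pow_add] using e01)
    · exact (neg_one_pow_eq_one_iff_even (R := ℂ) (by norm_num)).mp
        (by simpa [pow_add] using e02)
  · intro hp
    refine ⟨fixed _ ?_ p hp, fixed _ ?_ p hp, fixed _ ?_ p hp⟩ <;>
    · rintro q (rfl | rfl | rfl | rfl) <;> simp [algebraMap_eq]
end

section
/- Let ε be a primitive third root of unity in ℂ and let φ : ℂ[T₁, T₂, T₃, T₄] → ℂ[x, y, z] be the ℂ-algebra homomorphism determined by φ(T₁) = x² + y² + z², φ(T₂) = xyz, φ(T₃) = x² + εy² + ε²z², φ(T₄) = x² + ε²y² + εz². Then the kernel of φ is the principal ideal generated by the polynomial T₁³ + T₃³ − 3T₁T₃T₄ + T₄³ − 27T₂². -/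
open MvPolynomial

/-- Modulo the relation, every polynomial in four variables is congruent to one of degree at
most one in the second variable. -/
lemma exists_sub_mem_span_coxring_relation (f : MvPolynomial (Fin 4) ℂ) :
    ∃ A B : MvPolynomial (Fin 3) ℂ,
      f - (rename ![0, 2, 3] A + X 1 * rename ![0, 2, 3] B) ∈
        Ideal.span {(X 0 ^ 3 + X 2 ^ 3 - 3 * X 0 * X 2 * X 3 + X 3 ^ 3 - 27 * X 1 ^ 2 :
          MvPolynomial (Fin 4) ℂ)} := by
  induction f using MvPolynomial.induction_on with
  | C a => exact ⟨C a, 0, by simp⟩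
  | add p q hp hq =>
    obtain ⟨A, B, h⟩ := hp
    obtain ⟨A', B', h'⟩ := hq
    refine ⟨A + A', B + B', ?_⟩
    convert add_mem h h' using 1
    simp only [map_add]
    ring
  | mul_X p i hp =>
    obtain ⟨A, B, h⟩ := hp
    have of_rename (j : Fin 3) (hj : ![0, 2, 3] j = i) : ∃ A B : MvPolynomial (Fin 3) ℂ,
        p * X i - (rename ![0, 2, 3] A + X 1 * rename ![0, 2, 3] B) ∈
          Ideal.span {(X 0 ^ 3 + X 2 ^ 3 - 3 * X 0 * X 2 * X 3 + X 3 ^ 3 - 27 * X 1 ^ 2 :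
            MvPolynomial (Fin 4) ℂ)} := by
      refine ⟨A * X j, B * X j, ?_⟩
      convert Ideal.mul_mem_right (X i) _ h using 1
      simp only [map_mul, rename_X, hj]
      ring
    have h27 : (C 27⁻¹ : MvPolynomial (Fin 4) ℂ) * 27 = 1 := by
      rw [← map_ofNat (C (σ := Fin 4) (R := ℂ)) 27, ← C_mul]
      norm_num
    fin_cases i
    · exact of_rename 0 rfl
    · refine ⟨C 27⁻¹ * (X 0 ^ 3 + X 1 ^ 3 - 3 * X 0 * X 1 * X 2 + X 2 ^ 3) * B, A, ?_⟩
      rw [Ideal.mem_span_singleton] at h ⊢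
      obtain ⟨c, hc⟩ := h
      refine ⟨c * X 1 - C 27⁻¹ * rename ![0, 2, 3] B, ?_⟩
      simp only [map_mul, map_add, map_sub, map_pow, rename_X, rename_C, map_ofNat]
      simp
      linear_combination X 1 * hc - X 1 ^ 2 * rename ![0, 2, 3] B * h27
    · exact of_rename 1 rfl
    · exact of_rename 2 rfl

lemma one_add_C_add_C_sq_eq_zero {σ : Type*} {ε : ℂ} (hε3 : ε ^ 3 = 1) (hε1 : ε ≠ 1) :
    1 + C ε + C ε ^ 2 = (0 : MvPolynomial σ ℂ) := by
  have hε : 1 + ε + ε ^ 2 = 0 := by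
    apply mul_left_cancel₀ (sub_ne_zero.2 hε1)
    linear_combination hε3
  simpa using congrArg (C (σ := σ)) hε

/-- The discrete Fourier transform on three variables is injective on polynomials. -/
lemma aeval_fourier_injective {ε : ℂ} (hε3 : ε ^ 3 = 1) (hε1 : ε ≠ 1) :
    Function.Injective
      (aeval ![X 0 + X 1 + X 2, X 0 + C ε * X 1 + C (ε ^ 2) * X 2,
          X 0 + C (ε ^ 2) * X 1 + C ε * X 2] :
        MvPolynomial (Fin 3) ℂ →ₐ[ℂ] MvPolynomial (Fin 3) ℂ) := by
  have hC := one_add_C_add_C_sq_eq_zero (σ := Fin 3) hε3 hε1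
  have h3 : (C 3⁻¹ : MvPolynomial (Fin 3) ℂ) * 3 = 1 := by
    rw [← map_ofNat (C (σ := Fin 3) (R := ℂ)) 3, ← C_mul]
    norm_num
  let L : MvPolynomial (Fin 3) ℂ →ₐ[ℂ] MvPolynomial (Fin 3) ℂ :=
    aeval ![X 0 + X 1 + X 2, X 0 + C ε * X 1 + C (ε ^ 2) * X 2,
      X 0 + C (ε ^ 2) * X 1 + C ε * X 2]
  let M : MvPolynomial (Fin 3) ℂ →ₐ[ℂ] MvPolynomial (Fin 3) ℂ :=
    aeval ![C 3⁻¹ * (X 0 + X 1 + X 2), C 3⁻¹ * (X 0 + C ε ^ 2 * X 1 + C ε * X 2),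
      C 3⁻¹ * (X 0 + C ε * X 1 + C ε ^ 2 * X 2)]
  have hML : M.comp L = AlgHom.id ℂ _ := by
    ext1 i
    fin_cases i
    · simp [L, M]
      linear_combination X 0 * h3 + (X 1 + X 2) * C 3⁻¹ * hC
    · simp [L, M]
      linear_combination X 1 * h3 + C 3⁻¹ * (X 0 + 2 * (C ε - 1) * X 1 +
        (1 - C ε + C ε ^ 2) * X 2) * hC
    · simp [L, M]
      linear_combination X 2 * h3 + C 3⁻¹ * (X 0 + 2 * (C ε - 1) * X 2 +
        (1 - C ε + C ε ^ 2) * X 1) * hC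
  exact Function.LeftInverse.injective (g := M) fun p => DFunLike.congr_fun hML p

/-- The three quadratic forms `x² + y² + z²`, `x² + εy² + ε²z²`, `x² + ε²y² + εz²` are
algebraically independent. -/
lemma algebraicIndependent_quadrics {ε : ℂ} (hε3 : ε ^ 3 = 1) (hε1 : ε ≠ 1) :
    AlgebraicIndependent ℂ
      ![(X 0 ^ 2 + X 1 ^ 2 + X 2 ^ 2 : MvPolynomial (Fin 3) ℂ),
        X 0 ^ 2 + C ε * X 1 ^ 2 + C (ε ^ 2) * X 2 ^ 2,
        X 0 ^ 2 + C (ε ^ 2) * X 1 ^ 2 + C ε * X 2 ^ 2] := by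
  have hcomp : aeval ![(X 0 ^ 2 + X 1 ^ 2 + X 2 ^ 2 : MvPolynomial (Fin 3) ℂ),
        X 0 ^ 2 + C ε * X 1 ^ 2 + C (ε ^ 2) * X 2 ^ 2,
        X 0 ^ 2 + C (ε ^ 2) * X 1 ^ 2 + C ε * X 2 ^ 2] = (expand 2).comp (aeval ![X 0 + X 1 + X 2,
          X 0 + C ε * X 1 + C (ε ^ 2) * X 2, X 0 + C (ε ^ 2) * X 1 + C ε * X 2]) := by
    ext1 i
    fin_cases i <;> simp
  rw [algebraicIndependent_iff_injective_aeval, hcomp, AlgHom.coe_comp]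
  exact (expand_injective two_pos).comp (aeval_fourier_injective hε3 hε1)

/-- Let `ε` be a primitive third root of unity and `φ : ℂ[T₁,…,T₄] → ℂ[x,y,z]` the
`ℂ`-algebra homomorphism with `φ(T₁) = x² + y² + z²`, `φ(T₂) = xyz`,
`φ(T₃) = x² + εy² + ε²z²`, `φ(T₄) = x² + ε²y² + εz²`. Then the kernel of `φ` is the
principal ideal generated by `T₁³ + T₃³ − 3T₁T₃T₄ + T₄³ − 27T₂²`. -/
theorem ker_coxring_A4
    (ε : ℂ) (hε3 : ε ^ 3 = 1) (hε1 : ε ≠ 1) :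
    RingHom.ker
      (MvPolynomial.aeval
        ![X 0 ^ 2 + X 1 ^ 2 + X 2 ^ 2,
          X 0 * X 1 * X 2,
          X 0 ^ 2 + C ε * X 1 ^ 2 + C (ε ^ 2) * X 2 ^ 2,
          X 0 ^ 2 + C (ε ^ 2) * X 1 ^ 2 + C ε * X 2 ^ 2] :
        MvPolynomial (Fin 4) ℂ →ₐ[ℂ] MvPolynomial (Fin 3) ℂ) =
      Ideal.span
        {X 0 ^ 3 + X 2 ^ 3 - 3 * X 0 * X 2 * X 3 + X 3 ^ 3 - 27 * X 1 ^ 2} := by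
  set φ : MvPolynomial (Fin 4) ℂ →ₐ[ℂ] MvPolynomial (Fin 3) ℂ := aeval _ with hφ
  have hC := one_add_C_add_C_sq_eq_zero (σ := Fin 3) hε3 hε1
  have hle : Ideal.span
      {X 0 ^ 3 + X 2 ^ 3 - 3 * X 0 * X 2 * X 3 + X 3 ^ 3 - 27 * X 1 ^ 2} ≤ RingHom.ker φ := by
    rw [Ideal.span_singleton_le_iff_mem, RingHom.mem_ker]
    simp only [hφ, map_add, map_sub, map_mul, map_pow, map_ofNat, aeval_X, Matrix.cons_val]
    grind
  refine le_antisymm (fun f hf => ?_) hle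
  obtain ⟨A, B, hAB⟩ := exists_sub_mem_span_coxring_relation f
  let q : Fin 3 → MvPolynomial (Fin 3) ℂ := ![X 0 ^ 2 + X 1 ^ 2 + X 2 ^ 2,
        X 0 ^ 2 + C ε * X 1 ^ 2 + C (ε ^ 2) * X 2 ^ 2,
        X 0 ^ 2 + C (ε ^ 2) * X 1 ^ 2 + C ε * X 2 ^ 2]
  have hq : AlgebraicIndependent ℂ q := algebraicIndependent_quadrics hε3 hε1
  have hφq (P : MvPolynomial (Fin 3) ℂ) : φ (rename ![0, 2, 3] P) = aeval q P := by
    rw [hφ, aeval_rename]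
    congr 2
    ext1 i
    fin_cases i <;> rfl
  have hsum : aeval q A + X 0 * X 1 * X 2 * aeval q B = 0 := by
    have h := hle hAB
    rw [RingHom.mem_ker] at h hf
    rw [map_sub, hf, map_add, map_mul, hφq, hφq] at h
    have hX : φ (X 1) = X 0 * X 1 * X 2 := by simp [hφ]
    rw [hX] at h
    linear_combination -h
  let σ : MvPolynomial (Fin 3) ℂ →ₐ[ℂ] MvPolynomial (Fin 3) ℂ := aeval ![-X 0, X 1, X 2]
  have hσq (P : MvPolynomial (Fin 3) ℂ) : σ (aeval q P) = aeval q P := by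
    rw [← AlgHom.comp_apply, comp_aeval]
    congr 2
    ext1 i
    fin_cases i <;> simp [q, σ]
  have hdiff : aeval q A - X 0 * X 1 * X 2 * aeval q B = 0 := by
    have h := congrArg σ hsum
    simp only [map_add, map_mul, hσq, map_zero] at h
    simp only [σ, aeval_X, Matrix.cons_val] at h
    linear_combination h
  have hA : A = 0 := by
    refine hq.eq_zero_of_aeval_eq_zero A ?_
    have : (2 : MvPolynomial (Fin 3) ℂ) * aeval q A = 0 := by linear_combination hsum + hdiff
    simpa using this
  have hB : B = 0 := by
    refine hq.eq_zero_of_aeval_eq_zero B ?_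
    simpa [hA, X_ne_zero] using hsum
  simpa [hA, hB] using hAB
end
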